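/- arXiv:1703.08149 — 2 statements merged into one kernel-verified Lean document; each statement's English description precedes it below -/
import Mathlib

section
/- There exists a constant C₃ > 0 such that for every u ∈ C₀^∞(B⁴) satisfying ∫_{B⁴} |Δu(x)|² dx − 9 ∫_{B⁴} u(x)²/(1 − |x|²)⁴ dx ≤ 1, one has ∫_{B⁴} e^{32π²u(x)²} dx ≤ C₃. -/
open MeasureTheory Real

noncomputable section

/-- The Euclidean space `ℝ⁴`. -/
abbrev E4 := EuclideanSpace ℝ (Fin 4)

/-- The Euclidean Laplacian on `ℝ⁴`. -/
def lapE (u : E4 → ℝ) (x : E4) : ℝ :=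
  ∑ i, fderiv ℝ (fun y => fderiv ℝ u y (EuclideanSpace.single i 1)) x (EuclideanSpace.single i 1)

end

open Filter Topology
open scoped ENNReal ProbabilityTheory

/-- `w` has partial derivative `d` in the `i`-th coordinate direction at `y`. -/
def HasPD (i : Fin 4) (w : E4 → ℝ) (d : ℝ) (y : E4) : Prop :=
  HasLineDerivAt ℝ w d y (EuclideanSpace.single i 1)

/-- The `i`-th partial derivative. -/
noncomputable def pd (i : Fin 4) (w : E4 → ℝ) (y : E4) : ℝ :=
  fderiv ℝ w y (EuclideanSpace.single i 1)

lemma lapE_eq (u : E4 → ℝ) (x : E4) : lapE u x = ∑ i, pd i (pd i u) x := rfl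

namespace HasPD

variable {i : Fin 4} {w₁ w₂ : E4 → ℝ} {d₁ d₂ c : ℝ} {y : E4}

lemma of_differentiableAt (h : DifferentiableAt ℝ w₁ y) : HasPD i w₁ (pd i w₁ y) y :=
  h.hasFDerivAt.hasLineDerivAt _

lemma pd_eq (h : HasPD i w₁ d₁ y) (hd : DifferentiableAt ℝ w₁ y) : pd i w₁ y = d₁ :=
  (HasLineDerivAt.lineDeriv (of_differentiableAt (i := i) hd)).symm.trans h.lineDeriv

lemma congr_deriv (h : HasPD i w₁ d₁ y) (e : d₁ = d₂) : HasPD i w₁ d₂ y := e ▸ h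

lemma const : HasPD i (fun _ => c) 0 y := hasDerivAt_const _ _

lemma add (h₁ : HasPD i w₁ d₁ y) (h₂ : HasPD i w₂ d₂ y) :
    HasPD i (fun z => w₁ z + w₂ z) (d₁ + d₂) y := HasDerivAt.fun_add h₁ h₂

lemma sub (h₁ : HasPD i w₁ d₁ y) (h₂ : HasPD i w₂ d₂ y) :
    HasPD i (fun z => w₁ z - w₂ z) (d₁ - d₂) y := HasDerivAt.fun_sub h₁ h₂

lemma mul (h₁ : HasPD i w₁ d₁ y) (h₂ : HasPD i w₂ d₂ y) :
    HasPD i (fun z => w₁ z * w₂ z) (d₁ * w₂ y + w₁ y * d₂) y := by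
  have := HasDerivAt.fun_mul h₁ h₂
  unfold HasPD HasLineDerivAt
  simpa using this

lemma inv (h₁ : HasPD i w₁ d₁ y) (h : w₁ y ≠ 0) :
    HasPD i (fun z => (w₁ z)⁻¹) (-d₁ / w₁ y ^ 2) y := by
  have := HasDerivAt.fun_inv h₁ (by simpa using h)
  unfold HasPD HasLineDerivAt
  simpa using this

lemma sum {ι : Type*} {s : Finset ι} {w : ι → E4 → ℝ} {d : ι → ℝ}
    (h : ∀ j ∈ s, HasPD i (w j) (d j) y) :
    HasPD i (fun z => ∑ j ∈ s, w j z) (∑ j ∈ s, d j) y := HasDerivAt.fun_sum h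

lemma coord (j : Fin 4) : HasPD i (fun z => z j) (if j = i then 1 else 0) y := by
  have : HasDerivAt (fun t : ℝ => y j + t * (if j = i then 1 else 0))
      (1 * (if j = i then 1 else 0)) 0 :=
    ((hasDerivAt_id (0 : ℝ)).mul_const _).const_add _
  unfold HasPD HasLineDerivAt
  convert! this using 1
  · ext t; simp
  · simp

end HasPD

/-- Smooth functions with compact support in the open unit ball. -/
structure TestFn (w : E4 → ℝ) : Prop where
  smooth : ContDiff ℝ (⊤ : ℕ∞) w
  compact : HasCompactSupport w
  sub : tsupport w ⊆ Metric.ball (0 : E4) 1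

namespace TestFn

variable {w w₁ w₂ g : E4 → ℝ}

lemma of_support (hc : ∀ y ∈ tsupport w₁, ContDiffAt ℝ (⊤ : ℕ∞) w y) (h₁ : TestFn w₁)
    (hs : Function.support w ⊆ Function.support w₁) : TestFn w := by
  have hs' : tsupport w ⊆ tsupport w₁ := closure_mono hs
  refine ⟨?_, h₁.compact.mono hs, hs'.trans h₁.sub⟩
  rw [contDiff_iff_contDiffAt]
  intro y
  by_cases hy : y ∈ tsupport w₁
  · exact hc y hy
  · have : w =ᶠ[nhds y] fun _ => 0 :=
      notMem_tsupport_iff_eventuallyEq.mp (fun h => hy (hs' h))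
    exact contDiffAt_const.congr_of_eventuallyEq this

lemma mul_right (h : TestFn w) (hg : ∀ y ∈ Metric.ball (0 : E4) 1, ContDiffAt ℝ (⊤ : ℕ∞) g y) :
    TestFn (fun y => w y * g y) :=
  of_support (fun y hy => h.smooth.contDiffAt.mul (hg y (h.sub hy))) h
    (fun _ hy => left_ne_zero_of_mul hy)

lemma mul (h : TestFn w) (hg : TestFn g) : TestFn (fun y => w y * g y) :=
  h.mul_right fun _ _ => hg.smooth.contDiffAt

lemma mul_left (h : TestFn w) (hg : ∀ y ∈ Metric.ball (0 : E4) 1, ContDiffAt ℝ (⊤ : ℕ∞) g y) :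
    TestFn (fun y => g y * w y) := by
  simpa only [mul_comm] using h.mul_right hg

lemma const_mul (c : ℝ) (h : TestFn w) : TestFn (fun y => c * w y) :=
  h.mul_left fun _ _ => contDiffAt_const

lemma add (h₁ : TestFn w₁) (h₂ : TestFn w₂) : TestFn (fun y => w₁ y + w₂ y) := by
  refine ⟨h₁.smooth.add h₂.smooth, h₁.compact.add h₂.compact, ?_⟩
  exact (tsupport_add w₁ w₂).trans (Set.union_subset h₁.sub h₂.sub)

lemma sub' (h₁ : TestFn w₁) (h₂ : TestFn w₂) : TestFn (fun y => w₁ y - w₂ y) := by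
  simpa [sub_eq_add_neg] using h₁.add (h₂.const_mul (-1))

lemma pow (h : TestFn w) {n : ℕ} (hn : n ≠ 0) : TestFn (fun y => w y ^ n) :=
  of_support (fun _ _ => (h.smooth.pow n).contDiffAt) h (fun y hy h0 => hy (by simp [h0, hn]))

lemma sum {ι : Type*} {s : Finset ι} (hs : s.Nonempty) {w : ι → E4 → ℝ}
    (h : ∀ j, TestFn (w j)) : TestFn (fun y => ∑ j ∈ s, w j y) := by
  induction hs using Finset.Nonempty.cons_induction with
  | singleton a => simpa using h a
  | cons a s ha hs ih => simp only [Finset.sum_cons]; exact (h a).add ih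

lemma differentiableAt (h : TestFn w) (y : E4) : DifferentiableAt ℝ w y :=
  (h.smooth.differentiable (by simp)).differentiableAt

lemma hasPD (h : TestFn w) (i : Fin 4) (y : E4) : HasPD i w (pd i w y) y :=
  .of_differentiableAt (h.differentiableAt y)

lemma pd (h : TestFn w) (i : Fin 4) : TestFn (pd i w) := by
  refine ⟨?_, h.compact.fderiv_apply ℝ _, (tsupport_fderiv_apply_subset ℝ _).trans h.sub⟩
  exact (h.smooth.fderiv_right (m := (⊤ : ℕ∞)) (by simp)).clm_apply contDiff_const

lemma lapE (h : TestFn w) : TestFn (lapE w) :=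
  sum (s := Finset.univ) ⟨0, Finset.mem_univ _⟩ fun i => (h.pd i).pd i

lemma integrable (h : TestFn w) : Integrable w :=
  h.smooth.continuous.integrable_of_hasCompactSupport h.compact

lemma eq_zero (h : TestFn w) {y : E4} (hy : y ∉ Metric.ball (0 : E4) 1) : w y = 0 :=
  image_eq_zero_of_notMem_tsupport fun hy' => hy (h.sub hy')

lemma pd_comm (h : TestFn w) (i j : Fin 4) (y : E4) :
    _root_.pd i (_root_.pd j w) y = _root_.pd j (_root_.pd i w) y := by
  have hs : IsSymmSndFDerivAt ℝ w y :=
    (h.smooth.contDiffAt (x := y)).isSymmSndFDerivAt (by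
      simp only [minSmoothness_of_isRCLikeNormedField]
      exact WithTop.coe_le_coe.mpr le_top)
  have hd : DifferentiableAt ℝ (fderiv ℝ w) y :=
    ((h.smooth.fderiv_right (m := (⊤ : ℕ∞)) (by simp)).differentiable (by simp)).differentiableAt
  have key : ∀ a b : Fin 4, _root_.pd a (_root_.pd b w) y =
      fderiv ℝ (fderiv ℝ w) y (EuclideanSpace.single a 1) (EuclideanSpace.single b 1) := by
    intro a b
    change fderiv ℝ (fun z => fderiv ℝ w z (EuclideanSpace.single b 1)) y _ = _
    rw [fderiv_clm_apply hd (differentiableAt_const _)]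
    simp
  rw [key, key, hs]

lemma integral_pd (h : TestFn w) (i : Fin 4) : ∫ y, _root_.pd i w y = 0 := by
  have := integral_mul_fderiv_eq_neg_fderiv_mul_of_integrable (𝕜 := ℝ) (μ := (volume : Measure E4))
    (f := w) (g := fun _ => 1) (v := EuclideanSpace.single i 1)
    (by simpa using (show Integrable (fun x => fderiv ℝ w x (EuclideanSpace.single i 1)) volume from
      (h.pd i).integrable)) (by simp) (by simpa using h.integrable)
    (fun x _ => h.differentiableAt x) (fun x _ => differentiableAt_const _)
  simpa [_root_.pd] using this

end TestFn

/-- The divergence theorem for vector fields compactly supported in the ball. -/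
lemma integral_div_eq_zero {F : Fin 4 → E4 → ℝ} {G : E4 → ℝ} (hF : ∀ i, TestFn (F i))
    (hG : ∀ y ∈ Metric.ball (0 : E4) 1, ∃ d : Fin 4 → ℝ,
      (∀ i, HasPD i (F i) (d i) y) ∧ ∑ i, d i = G y) :
    IntegrableOn G (Metric.ball 0 1) ∧ ∫ y in Metric.ball (0 : E4) 1, G y = 0 := by
  have hEq : Set.EqOn (fun y => ∑ i, pd i (F i) y) G (Metric.ball 0 1) := by
    intro y hy
    obtain ⟨d, hd, hs⟩ := hG y hy
    simp only [← hs]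
    exact Finset.sum_congr rfl fun i _ => (hd i).pd_eq ((hF i).differentiableAt y)
  have hT : TestFn (fun y => ∑ i, pd i (F i) y) :=
    TestFn.sum (s := Finset.univ) ⟨0, Finset.mem_univ _⟩ fun i => (hF i).pd i
  refine ⟨hT.integrable.integrableOn.congr_fun hEq measurableSet_ball, ?_⟩
  rw [← setIntegral_congr_fun measurableSet_ball hEq,
    setIntegral_eq_integral_of_forall_compl_eq_zero (fun y hy => hT.eq_zero hy),
    integral_finsetSum _ fun i _ => ((hF i).pd i).integrable]
  exact Finset.sum_eq_zero fun i _ => (hF i).integral_pd i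

/-- The conformal weight `(1 - |y|²) / 2` of the ball. -/
noncomputable def wt (y : E4) : ℝ := (1 - ‖y‖ ^ 2) / 2

lemma norm_sq_eq_sum (y : E4) : ‖y‖ ^ 2 = ∑ i, y i ^ 2 := EuclideanSpace.real_norm_sq_eq y

lemma contDiff_wt : ContDiff ℝ (⊤ : ℕ∞) wt :=
  (contDiff_const.sub (contDiff_norm_sq ℝ)).div_const 2

lemma wt_pos {y : E4} (hy : y ∈ Metric.ball (0 : E4) 1) : 0 < wt y := by
  have h : ‖y‖ < 1 := by simpa using hy
  unfold wt
  nlinarith [norm_nonneg y]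

lemma wt_le (y : E4) : wt y ≤ 1 / 2 := by
  unfold wt
  nlinarith [norm_nonneg y]

lemma contDiffAt_inv_wt {y : E4} (hy : y ∈ Metric.ball (0 : E4) 1) :
    ContDiffAt ℝ (⊤ : ℕ∞) (fun y => (wt y)⁻¹) y :=
  contDiff_wt.contDiffAt.inv (wt_pos hy).ne'

lemma contDiff_coord (i : Fin 4) : ContDiff ℝ (⊤ : ℕ∞) (fun y : E4 => y i) :=
  (EuclideanSpace.proj (𝕜 := ℝ) i : E4 →L[ℝ] ℝ).contDiff

lemma hasPD_sum_mul_coord (c : E4) (i : Fin 4) (y : E4) :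
    HasPD i (fun z => ∑ j, z j * c j) (c i) y := by
  refine (HasPD.sum fun j _ => (HasPD.coord j).mul HasPD.const).congr_deriv ?_
  simp

lemma hasPD_norm_sq (i : Fin 4) (y : E4) : HasPD i (fun z => ‖z‖ ^ 2) (2 * y i) y := by
  simp only [norm_sq_eq_sum]
  simp only [pow_two]
  refine (HasPD.sum fun j _ => (HasPD.coord j).mul (HasPD.coord j)).congr_deriv ?_
  simp [Finset.sum_add_distrib]
  ring

lemma hasPD_wt (i : Fin 4) (y : E4) : HasPD i wt (-y i) y := by
  have := ((HasPD.const (c := 1)).sub (hasPD_norm_sq i y)).mul (HasPD.const (c := 2⁻¹))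
  simp only [← div_eq_mul_inv] at this
  refine HasPD.congr_deriv this ?_
  ring

lemma pd_wt_mul {v : E4 → ℝ} (hv : TestFn v) (i : Fin 4) (y : E4) :
    pd i (fun z => wt z * v z) y = wt y * pd i v y - y i * v y := by
  have h := (hasPD_wt i y).mul (hv.hasPD i y)
  rw [h.pd_eq ((contDiff_wt.differentiable (by simp)).differentiableAt.mul (hv.differentiableAt y))]
  ring

lemma TestFn.wt_mul {v : E4 → ℝ} (hv : TestFn v) : TestFn (fun z => wt z * v z) :=
  hv.mul_left fun _ _ => contDiff_wt.contDiffAt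

lemma TestFn.mul_coord {v : E4 → ℝ} (hv : TestFn v) (i : Fin 4) : TestFn (fun z => v z * z i) :=
  hv.mul_right fun _ _ => (contDiff_coord i).contDiffAt

lemma TestFn.div_wt {v : E4 → ℝ} (hv : TestFn v) : TestFn (fun z => v z / wt z) :=
  hv.mul_right fun _ hy => contDiffAt_inv_wt hy

lemma lapE_wt_mul {v : E4 → ℝ} (hv : TestFn v) (y : E4) :
    lapE (fun z => wt z * v z) y
      = wt y * lapE v y - 2 * (∑ i, y i * pd i v y) - 4 * v y := by
  have h : ∀ i, pd i (pd i fun z => wt z * v z) y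
      = wt y * pd i (pd i v) y - 2 * (y i * pd i v y) - v y := by
    intro i
    have e : (pd i fun z => wt z * v z) = fun z => wt z * pd i v z - z i * v z :=
      funext fun z => pd_wt_mul hv i z
    rw [HasPD.pd_eq (d₁ := wt y * pd i (pd i v) y - 2 * (y i * pd i v y) - v y) ?_
      ((hv.wt_mul.pd i).differentiableAt y)]
    rw [e]
    refine (((hasPD_wt i y).mul ((hv.pd i).hasPD i y)).sub
      ((HasPD.coord i).mul (hv.hasPD i y))).congr_deriv ?_
    simp
    ring
  rw [lapE_eq, lapE_eq]
  simp only [h, Finset.sum_sub_distrib, ← Finset.mul_sum]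
  simp

/-- The function `b (Δ v + v / (4 b²))`, where `b` is the weight of the ball. -/
noncomputable def hardyOp (v : E4 → ℝ) (y : E4) : ℝ := wt y * lapE v y + v y / (4 * wt y)

/-- The Hardy deficit density `|∇ v|² - v² / (4 b²)`. -/
noncomputable def deficit (v : E4 → ℝ) (y : E4) : ℝ :=
  ∑ i, pd i v y ^ 2 - v y ^ 2 / (4 * wt y ^ 2)

lemma TestFn.hardyOp {v : E4 → ℝ} (hv : TestFn v) : TestFn (hardyOp v) := by
  refine TestFn.add hv.lapE.wt_mul (hv.mul_right (g := fun y => (4 * wt y)⁻¹) fun y hy => ?_)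
  exact (contDiffAt_const.mul contDiff_wt.contDiffAt).inv (by have := wt_pos hy; positivity)

lemma TestFn.deficit {v : E4 → ℝ} (hv : TestFn v) : TestFn (deficit v) := by
  refine TestFn.sub' (TestFn.sum (s := Finset.univ) ⟨0, Finset.mem_univ _⟩
    fun i => (hv.pd i).pow two_ne_zero)
    ((hv.pow two_ne_zero).mul_right (g := fun y => (4 * wt y ^ 2)⁻¹) fun y hy => ?_)
  exact (contDiffAt_const.mul (contDiff_wt.contDiffAt.pow 2)).inv
    (by have := wt_pos hy; positivity)

lemma energy_identity {v : E4 → ℝ} (hv : TestFn v) :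
    (∫ x in Metric.ball (0 : E4) 1, |lapE (fun z => wt z * v z) x| ^ 2)
        - 9 * (∫ x in Metric.ball (0 : E4) 1, (wt x * v x) ^ 2 / (1 - ‖x‖ ^ 2) ^ 4)
      = (∫ x in Metric.ball (0 : E4) 1, hardyOp v x ^ 2)
        + 5 / 2 * ∫ x in Metric.ball (0 : E4) 1, deficit v x := by
  set S : E4 → ℝ := fun y => ∑ j, pd j v y * y j with hS
  set P : E4 → ℝ := fun y => ∑ j, pd j v y ^ 2 with hP
  have hne : (Finset.univ : Finset (Fin 4)).Nonempty := ⟨0, Finset.mem_univ _⟩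
  have hST : TestFn S := TestFn.sum hne fun j => (hv.pd j).mul_coord j
  have hPT : TestFn P := TestFn.sum hne fun j => (hv.pd j).pow two_ne_zero
  have hdiv := integral_div_eq_zero
    (F := fun i y => wt y * (-4 * (S y * pd i v y) + 2 * (P y * y i) - 8 * (v y * pd i v y))
      + (4 * ((v y * v y) * y i) - 1 / 2 * (v y * pd i v y)))
    (G := fun y => |lapE (fun z => wt z * v z) y| ^ 2
        - 9 * ((wt y * v y) ^ 2 / (1 - ‖y‖ ^ 2) ^ 4)
        - (hardyOp v y ^ 2 + 5 / 2 * deficit v y))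
    (fun i => (TestFn.wt_mul ((((hST.mul (hv.pd i)).const_mul _).add
      ((hPT.mul_coord i).const_mul _)).sub' ((hv.mul (hv.pd i)).const_mul _))).add
        ((((hv.mul hv).mul_coord i).const_mul _).sub' ((hv.mul (hv.pd i)).const_mul _)))
    ?_
  · have hi1 : IntegrableOn (fun y => |lapE (fun z => wt z * v z) y| ^ 2) (Metric.ball 0 1) := by
      simp only [sq_abs]
      exact (hv.wt_mul.lapE.pow two_ne_zero).integrable.integrableOn
    have hi3 : IntegrableOn (fun y => hardyOp v y ^ 2) (Metric.ball 0 1) :=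
      (hv.hardyOp.pow two_ne_zero).integrable.integrableOn
    have hi4 : IntegrableOn (fun y => 5 / 2 * deficit v y) (Metric.ball 0 1) :=
      (hv.deficit.const_mul _).integrable.integrableOn
    have hi2 : IntegrableOn (fun y => 9 * ((wt y * v y) ^ 2 / (1 - ‖y‖ ^ 2) ^ 4))
        (Metric.ball 0 1) := by
      refine TestFn.integrable (TestFn.const_mul 9 ((hv.wt_mul.pow two_ne_zero).mul_right
        (g := fun y => ((1 - ‖y‖ ^ 2) ^ 4)⁻¹) fun y hy => ?_)) |>.integrableOn
      have h0 := wt_pos hy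
      unfold wt at h0
      exact ((contDiff_const.sub (contDiff_norm_sq ℝ)).contDiffAt.pow 4).inv
        (pow_ne_zero _ (by simp; linarith))
    have h2 := hdiv.2
    have h3 := integral_sub (hi1.sub hi2) (hi3.add hi4)
    simp only [Pi.sub_apply, Pi.add_apply] at h3
    rw [h3, integral_sub hi1 hi2, integral_add hi3 hi4,
      integral_const_mul, integral_const_mul] at h2
    linarith
  · intro y hy
    have hb := wt_pos hy
    have hb2 : 1 - ‖y‖ ^ 2 = 2 * wt y := by unfold wt; ring
    have dS : ∀ i, HasPD i S (pd i v y + ∑ j, pd i (pd j v) y * y j) y := by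
      intro i
      refine (HasPD.sum fun j _ => ((hv.pd j).hasPD i y).mul (HasPD.coord j)).congr_deriv ?_
      simp [Finset.sum_add_distrib, add_comm]
    have dP : ∀ i, HasPD i P (2 * ∑ j, pd j v y * pd i (pd j v) y) y := by
      intro i
      simp only [hP, pow_two]
      refine (HasPD.sum fun j _ => ((hv.pd j).hasPD i y).mul ((hv.pd j).hasPD i y)).congr_deriv ?_
      rw [Finset.mul_sum]
      exact Finset.sum_congr rfl fun j _ => by ring
    refine ⟨_, fun i => ((hasPD_wt i y).mul
      ((((HasPD.const (c := -4)).mul ((dS i).mul ((hv.pd i).hasPD i y))).add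
        ((HasPD.const (c := 2)).mul ((dP i).mul (HasPD.coord i)))).sub
        ((HasPD.const (c := 8)).mul ((hv.hasPD i y).mul ((hv.pd i).hasPD i y))))).add
      (((HasPD.const (c := 4)).mul (((hv.hasPD i y).mul (hv.hasPD i y)).mul (HasPD.coord i))).sub
        ((HasPD.const (c := 1 / 2)).mul ((hv.hasPD i y).mul ((hv.pd i).hasPD i y)))), ?_⟩
    simp only [sq_abs, lapE_wt_mul hv, hardyOp, deficit, hb2, if_true, lapE_eq]
    have e : ∀ L T : ℝ, (wt y * L - 2 * T - 4 * v y) ^ 2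
        - 9 * ((wt y * v y) ^ 2 / (2 * wt y) ^ 4)
        - ((wt y * L + v y / (4 * wt y)) ^ 2 + 5 / 2 * (P y - v y ^ 2 / (4 * wt y ^ 2)))
        = (wt y * L - 2 * T - 4 * v y) ^ 2 - wt y ^ 2 * L ^ 2 - 1 / 2 * v y * L
          - 5 / 2 * P y := by
      intro L T
      field_simp
      ring
    refine Eq.trans ?_ (e _ _).symm
    have hx : y 0 ^ 2 + y 1 ^ 2 + y 2 ^ 2 + y 3 ^ 2 = 1 - 2 * wt y := by
      rw [← hb2, norm_sq_eq_sum, Fin.sum_univ_four]; ring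
    have hx' : y 0 ^ 2 = 1 - 2 * wt y - y 1 ^ 2 - y 2 ^ 2 - y 3 ^ 2 := by linarith
    simp only [hS, hP, Fin.sum_univ_four, hv.pd_comm 1 0, hv.pd_comm 2 0, hv.pd_comm 3 0,
      hv.pd_comm 2 1, hv.pd_comm 3 1, hv.pd_comm 3 2]
    generalize wt y = b at *
    generalize v y = v0 at *
    generalize pd 0 v y = p0 at *
    generalize pd 1 v y = p1 at *
    generalize pd 2 v y = p2 at *
    generalize pd 3 v y = p3 at *
    linear_combination (-2 * (p0 ^ 2 + p1 ^ 2 + p2 ^ 2 + p3 ^ 2)) * hx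

/-- The Euclidean inner product, in coordinates. -/
noncomputable def dotE (x y : E4) : ℝ := ∑ j, y j * x j

/-- The squared distance `|y - x|²`. -/
noncomputable def sqDist (x y : E4) : ℝ := ‖y‖ ^ 2 - 2 * dotE x y + ‖x‖ ^ 2

/-- The reflected squared distance `1 - 2 x·y + |x|²|y|²`. -/
noncomputable def reflDist (x y : E4) : ℝ := 1 - 2 * dotE x y + ‖x‖ ^ 2 * ‖y‖ ^ 2

lemma sqDist_eq (x y : E4) : sqDist x y = ‖y - x‖ ^ 2 := by
  simp only [sqDist, dotE, norm_sq_eq_sum, Fin.sum_univ_four, PiLp.sub_apply]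
  ring

lemma sqDist_nonneg (x y : E4) : 0 ≤ sqDist x y := by
  rw [sqDist_eq]; positivity

lemma reflDist_eq (x y : E4) : reflDist x y = sqDist x y + 4 * wt x * wt y := by
  unfold reflDist sqDist wt; ring

lemma dotE_le (x y : E4) : dotE x y ≤ ‖x‖ * ‖y‖ := by
  have h := real_inner_le_norm y x
  have e : inner ℝ y x = dotE x y := by
    simp [PiLp.inner_apply, dotE, mul_comm]
  rw [e] at h
  linarith [mul_comm ‖x‖ ‖y‖]

lemma sq_wt_le_reflDist {x y : E4} (hx : x ∈ Metric.ball (0 : E4) 1)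
    (hy : y ∈ Metric.ball (0 : E4) 1) : wt x ^ 2 ≤ reflDist x y := by
  have h1 : ‖x‖ < 1 := by simpa using hx
  have h2 : ‖y‖ < 1 := by simpa using hy
  have h3 := dotE_le x y
  have n1 := norm_nonneg x
  have n2 := norm_nonneg y
  have h5 : ‖x‖ * ‖y‖ ≤ ‖x‖ := by nlinarith
  have h6 : wt x ≤ 1 - ‖x‖ * ‖y‖ := by unfold wt; nlinarith
  have h7 : (1 - ‖x‖ * ‖y‖) ^ 2 ≤ reflDist x y := by unfold reflDist; nlinarith
  nlinarith [wt_pos hx]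

lemma reflDist_symm (x y : E4) : reflDist x y = reflDist y x := by
  simp only [reflDist, dotE, mul_comm]

lemma reflDist_pos {x y : E4} (hx : x ∈ Metric.ball (0 : E4) 1)
    (hy : y ∈ Metric.ball (0 : E4) 1) : 0 < reflDist x y :=
  lt_of_lt_of_le (pow_pos (wt_pos hx) 2) (sq_wt_le_reflDist hx hy)

/-- `α` has gradient `p • y + r • x` at `y`. -/
def HasGr (x : E4) (α : E4 → ℝ) (p r : ℝ) (y : E4) : Prop :=
  ∀ i, HasPD i α (p * y i + r * x i) y

namespace HasGr

variable {x y : E4} {α β : E4 → ℝ} {p r p' r' c : ℝ}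

lemma congr (h : HasGr x α p r y) (e : p = p') (e' : r = r') : HasGr x α p' r' y := e ▸ e' ▸ h

lemma const : HasGr x (fun _ => c) 0 0 y := fun _ => HasPD.const.congr_deriv (by ring)

lemma add (h : HasGr x α p r y) (h' : HasGr x β p' r' y) :
    HasGr x (fun z => α z + β z) (p + p') (r + r') y :=
  fun i => ((h i).add (h' i)).congr_deriv (by ring)

lemma mul (h : HasGr x α p r y) (h' : HasGr x β p' r' y) :
    HasGr x (fun z => α z * β z) (p * β y + α y * p') (r * β y + α y * r') y :=
  fun i => ((h i).mul (h' i)).congr_deriv (by ring)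

lemma inv (h : HasGr x α p r y) (h0 : α y ≠ 0) :
    HasGr x (fun z => (α z)⁻¹) (-p * (α y)⁻¹ ^ 2) (-r * (α y)⁻¹ ^ 2) y :=
  fun i => ((h i).inv h0).congr_deriv (by field_simp; ring)

lemma const_mul (h : HasGr x α p r y) : HasGr x (fun z => c * α z) (c * p) (c * r) y :=
  fun i => (HasPD.const.mul (h i)).congr_deriv (by ring)

lemma wt : HasGr x wt (-1) 0 y := fun i => (hasPD_wt i y).congr_deriv (by ring)

lemma sqDist : HasGr x (sqDist x) 2 (-2) y := fun i =>
  (((hasPD_norm_sq i y).sub (HasPD.const.mul (hasPD_sum_mul_coord x i y))).add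
    HasPD.const).congr_deriv (by ring)

lemma reflDist : HasGr x (reflDist x) (2 * ‖x‖ ^ 2) (-2) y := fun i =>
  ((HasPD.const.sub (HasPD.const.mul (hasPD_sum_mul_coord x i y))).add
    (HasPD.const.mul (hasPD_norm_sq i y))).congr_deriv (by ring)

/-- The divergence of `α y + β x`. -/
lemma sum_div (h : HasGr x α p r y) (h' : HasGr x β p' r' y) :
    ∃ d : Fin 4 → ℝ, (∀ i, HasPD i (fun z => α z * z i + β z * x i) (d i) y) ∧
      ∑ i, d i = 4 * α y + p * ‖y‖ ^ 2 + (r + p') * dotE x y + r' * ‖x‖ ^ 2 := by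
  refine ⟨_, fun i => ((h i).mul (HasPD.coord i)).add ((h' i).mul HasPD.const), ?_⟩
  simp only [norm_sq_eq_sum, dotE, Fin.sum_univ_four, if_true]
  ring

end HasGr

lemma contDiff_dotE (x : E4) : ContDiff ℝ (⊤ : ℕ∞) (dotE x) :=
  ContDiff.sum fun j _ => (contDiff_coord j).mul contDiff_const

lemma contDiff_sqDist (x : E4) : ContDiff ℝ (⊤ : ℕ∞) (sqDist x) :=
  ((contDiff_norm_sq ℝ).sub (contDiff_const.mul (contDiff_dotE x))).add contDiff_const

lemma contDiff_reflDist (x : E4) : ContDiff ℝ (⊤ : ℕ∞) (reflDist x) :=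
  (contDiff_const.sub (contDiff_const.mul (contDiff_dotE x))).add
    (contDiff_const.mul (contDiff_norm_sq ℝ))

/-- The divergence theorem for `∑ᵢ ∂ᵢ (v² Xᵢ + v Yᵢ - g ∂ᵢ v)`, with `X`, `Y` in the span of
`y` and `x`. -/
lemma integral_div_span {x : E4} {v g α₁ β₁ α₂ β₂ D₁ D₂ : E4 → ℝ} (hv : TestFn v)
    (cg : ∀ y ∈ Metric.ball (0 : E4) 1, ContDiffAt ℝ (⊤ : ℕ∞) g y)
    (c1 : ∀ y ∈ Metric.ball (0 : E4) 1, ContDiffAt ℝ (⊤ : ℕ∞) α₁ y)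
    (c2 : ∀ y ∈ Metric.ball (0 : E4) 1, ContDiffAt ℝ (⊤ : ℕ∞) β₁ y)
    (c3 : ∀ y ∈ Metric.ball (0 : E4) 1, ContDiffAt ℝ (⊤ : ℕ∞) α₂ y)
    (c4 : ∀ y ∈ Metric.ball (0 : E4) 1, ContDiffAt ℝ (⊤ : ℕ∞) β₂ y)
    {γ δ : E4 → ℝ}
    (hg : ∀ y ∈ Metric.ball (0 : E4) 1, HasGr x g (γ y) (δ y) y)
    (h1 : ∀ y ∈ Metric.ball (0 : E4) 1, ∃ p r p' r', HasGr x α₁ p r y ∧ HasGr x β₁ p' r' y ∧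
      4 * α₁ y + p * ‖y‖ ^ 2 + (r + p') * dotE x y + r' * ‖x‖ ^ 2 = D₁ y)
    (h2 : ∀ y ∈ Metric.ball (0 : E4) 1, ∃ p r p' r', HasGr x α₂ p r y ∧ HasGr x β₂ p' r' y ∧
      4 * α₂ y + p * ‖y‖ ^ 2 + (r + p') * dotE x y + r' * ‖x‖ ^ 2 = D₂ y) :
    let G := fun y => (v y * v y) * D₁ y + v y * D₂ y
      + (∑ i, pd i v y * (2 * v y * (α₁ y * y i + β₁ y * x i) + (α₂ y * y i + β₂ y * x i)
        - (γ y * y i + δ y * x i))) - g y * lapE v y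
    IntegrableOn G (Metric.ball 0 1) ∧ ∫ y in Metric.ball (0 : E4) 1, G y = 0 := by
  intro G
  have cxy : ∀ {α β : E4 → ℝ} {y : E4} (i : Fin 4), ContDiffAt ℝ (⊤ : ℕ∞) α y →
      ContDiffAt ℝ (⊤ : ℕ∞) β y →
      ContDiffAt ℝ (⊤ : ℕ∞) (fun y => α y * y i + β y * x i) y := fun i ha hb =>
    (ha.mul (contDiff_coord i).contDiffAt).add (hb.mul contDiffAt_const)
  refine integral_div_eq_zero
    (F := fun i y => ((v y * v y) * (α₁ y * y i + β₁ y * x i) + v y * (α₂ y * y i + β₂ y * x i))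
      - g y * pd i v y)
    (fun i => (((hv.mul hv).mul_right fun y hy => cxy i (c1 y hy) (c2 y hy)).add
      (hv.mul_right fun y hy => cxy i (c3 y hy) (c4 y hy))).sub' ((hv.pd i).mul_left cg)) ?_
  intro y hy
  obtain ⟨p, r, p', r', ha, hb, e⟩ := h1 y hy
  obtain ⟨p₂, r₂, p₂', r₂', ha₂, hb₂, e₂⟩ := h2 y hy
  obtain ⟨d, hd, hde⟩ := ha.sum_div hb
  obtain ⟨d₂, hd₂, hde₂⟩ := ha₂.sum_div hb₂
  refine ⟨_, fun i => ((((hv.hasPD i y).mul (hv.hasPD i y)).mul (hd i)).add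
    ((hv.hasPD i y).mul (hd₂ i))).sub ((hg y hy i).mul ((hv.pd i).hasPD i y)), ?_⟩
  simp only [G, ← e, ← e₂, ← hde, ← hde₂, Fin.sum_univ_four, lapE_eq]
  ring

lemma calibration_ineq {x : E4} (hx : x ∈ Metric.ball (0 : E4) 1) {ε : ℝ} (hε : 0 < ε) (K : ℝ)
    {v : E4 → ℝ} (hv : TestFn v) :
    ∃ G : E4 → ℝ, IntegrableOn G (Metric.ball 0 1) ∧ ∫ y in Metric.ball (0 : E4) 1, G y = 0 ∧
      ∀ y ∈ Metric.ball (0 : E4) 1,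
        G y + v y * (8 * ε * K * wt y ^ 2 / reflDist x y ^ 2 / (sqDist x y + ε) ^ 3) ≤
          - (K * wt y / reflDist x y ^ 2 / (sqDist x y + ε)) * hardyOp v y
          - 17 / 2 * (v y * (K * wt y * (sqDist x y / 2 + wt x + wt y) / reflDist x y ^ 3
              * (ε / (sqDist x y + ε) ^ 2)))
          + 1 / 2 * deficit v y
          + K ^ 2 * (wt y ^ 2 * sqDist x y / (32 * reflDist x y ^ 5 * (sqDist x y + ε) ^ 2)
            + 147 / 128 * wt y * sqDist x y ^ 2 /
              (wt x * reflDist x y ^ 5 * (sqDist x y + ε) ^ 2)) := by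
  set a := wt x with ha
  have ha0 : 0 < a := wt_pos hx
  set X := ‖x‖ ^ 2 with hX
  have hXa : X = 1 - 2 * a := by rw [ha, hX]; unfold wt; ring
  let N : E4 → ℝ := fun y => (sqDist x y + ε)⁻¹
  let ρ : E4 → ℝ := fun y => (reflDist x y)⁻¹
  let β : E4 → ℝ := fun y => (wt y)⁻¹
  have nD : ∀ y, sqDist x y + ε ≠ 0 := fun y => by have := sqDist_nonneg x y; positivity
  have gb : ∀ y ∈ Metric.ball (0 : E4) 1, HasGr x β _ _ y := fun y hy =>
    HasGr.wt.inv (wt_pos hy).ne'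
  have gρ : ∀ y ∈ Metric.ball (0 : E4) 1, HasGr x ρ _ _ y := fun y hy =>
    HasGr.reflDist.inv (reflDist_pos hx hy).ne'
  have gN : ∀ y, HasGr x N _ _ y := fun y => (HasGr.sqDist.add HasGr.const).inv (nD y)
  have cb : ∀ y ∈ Metric.ball (0 : E4) 1, ContDiffAt ℝ (⊤ : ℕ∞) β y := fun y hy =>
    contDiffAt_inv_wt hy
  have cρ : ∀ y ∈ Metric.ball (0 : E4) 1, ContDiffAt ℝ (⊤ : ℕ∞) ρ y := fun y hy =>
    (contDiff_reflDist x).contDiffAt.inv (reflDist_pos hx hy).ne'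
  have cN : ∀ y, ContDiffAt ℝ (⊤ : ℕ∞) N y := fun y =>
    ((contDiff_sqDist x).contDiffAt.add contDiffAt_const).inv (nD y)
  have cw : ∀ y, ContDiffAt ℝ (⊤ : ℕ∞) wt y := fun y => contDiff_wt.contDiffAt
  let A : E4 → ℝ := fun y => wt y * (wt y * (ρ y * (ρ y * N y)))
  let B : E4 → ℝ := fun y => wt y * (ρ y * (ρ y * N y))
  have gA0 : ∀ y ∈ Metric.ball (0 : E4) 1, HasGr x A _ _ y := fun y hy =>
    HasGr.wt.mul (HasGr.wt.mul ((gρ y hy).mul ((gρ y hy).mul (gN y))))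
  have gB0 : ∀ y ∈ Metric.ball (0 : E4) 1, HasGr x B _ _ y := fun y hy =>
    HasGr.wt.mul ((gρ y hy).mul ((gρ y hy).mul (gN y)))
  have cA : ∀ y ∈ Metric.ball (0 : E4) 1, ContDiffAt ℝ (⊤ : ℕ∞) A y := fun y hy =>
    (cw y).mul ((cw y).mul ((cρ y hy).mul ((cρ y hy).mul (cN y))))
  have cB : ∀ y ∈ Metric.ball (0 : E4) 1, ContDiffAt ℝ (⊤ : ℕ∞) B y := fun y hy =>
    (cw y).mul ((cρ y hy).mul ((cρ y hy).mul (cN y)))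
  have gA : ∀ y ∈ Metric.ball (0 : E4) 1, HasGr x A
      (-4 * X * (ρ y * A y) - 2 * B y - 2 * (N y * A y)) (4 * (ρ y * A y) + 2 * (N y * A y)) y := by
    intro y hy
    refine (gA0 y hy).congr ?_ ?_ <;>
    · simp only [A, B, ρ, N]
      ring
  have gB : ∀ y ∈ Metric.ball (0 : E4) 1, HasGr x B
      (-4 * X * (ρ y * B y) - ρ y * ρ y * N y - 2 * (N y * B y))
      (4 * (ρ y * B y) + 2 * (N y * B y)) y := by
    intro y hy
    refine (gB0 y hy).congr ?_ ?_ <;>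
    · simp only [B, ρ, N]
      ring
  let α₁ : E4 → ℝ := fun y => (-1 / 4) * β y + (-3 / 2 * X) * ρ y
  let β₁ : E4 → ℝ := fun y => 3 / 2 * ρ y
  let α₂ : E4 → ℝ := fun y => (-9 / 2 * X * K) * (ρ y * A y)
    + ((-9 / 4 * K) * B y + (-2 * K) * (N y * A y))
  let β₂ : E4 → ℝ := fun y => (9 / 2 * K) * (ρ y * A y) + (2 * K) * (N y * A y)
  let Xα : E4 → ℝ := fun y => -1 / 2 * β y - 3 * X * ρ y
  let Xβ : E4 → ℝ := fun y => 3 * ρ y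
  let Yα : E4 → ℝ := fun y => -1 / 4 * K * (2 * X * (ρ y * A y) + B y)
  let Yβ : E4 → ℝ := fun y => 1 / 2 * K * (ρ y * A y)
  let D₁ : E4 → ℝ := fun y => 1 / 2 * (-β y ^ 2 / 4 - 3 * a * β y * ρ y
      - (Xα y ^ 2 * ‖y‖ ^ 2 + 2 * Xα y * Xβ y * dotE x y + Xβ y ^ 2 * X))
  let D₂ : E4 → ℝ := fun y => -K * ρ y ^ 2 * N y / 4 - 8 * ε * K * A y * N y ^ 2
      - 17 / 2 * (ε * K * N y ^ 2 * (sqDist x y / 2 + a + wt y) * wt y * ρ y ^ 3)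
      + 21 / 8 * K * N y * sqDist x y * ρ y ^ 3
      - (Xα y * Yα y * ‖y‖ ^ 2 + (Xα y * Yβ y + Xβ y * Yα y) * dotE x y + Xβ y * Yβ y * X)
  have h1 : ∀ y ∈ Metric.ball (0 : E4) 1, ∃ p r p' r', HasGr x α₁ p r y ∧ HasGr x β₁ p' r' y ∧
      4 * α₁ y + p * ‖y‖ ^ 2 + (r + p') * dotE x y + r' * ‖x‖ ^ 2 = D₁ y := by
    intro y hy
    refine ⟨_, _, _, _, ((gb y hy).const_mul).add ((gρ y hy).const_mul), (gρ y hy).const_mul, ?_⟩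
    have hb := wt_pos hy
    have hR := reflDist_pos hx hy
    have hW : dotE x y = (1 + X * ‖y‖ ^ 2 - reflDist x y) / 2 := by unfold reflDist; ring
    have hY : ‖y‖ ^ 2 = 1 - 2 * wt y := by unfold wt; ring
    simp only [D₁, α₁, Xα, Xβ, β, ρ]
    rw [← hX, hW, hY, hXa]
    generalize reflDist x y = R at *
    generalize wt y = b at *
    field_simp
    ring
  have h2 : ∀ y ∈ Metric.ball (0 : E4) 1, ∃ p r p' r', HasGr x α₂ p r y ∧ HasGr x β₂ p' r' y ∧
      4 * α₂ y + p * ‖y‖ ^ 2 + (r + p') * dotE x y + r' * ‖x‖ ^ 2 = D₂ y := by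
    intro y hy
    refine ⟨_, _, _, _, (((gρ y hy).mul (gA y hy)).const_mul).add (((gB y hy).const_mul).add
      (((gN y).mul (gA y hy)).const_mul)), (((gρ y hy).mul (gA y hy)).const_mul).add
      (((gN y).mul (gA y hy)).const_mul), ?_⟩
    have hb := wt_pos hy
    have hR := reflDist_pos hx hy
    have hD : 0 < sqDist x y + ε := by have := sqDist_nonneg x y; positivity
    have hd : sqDist x y = reflDist x y - 4 * a * wt y := by rw [reflDist_eq]; ring
    have hW : dotE x y = (1 + X * ‖y‖ ^ 2 - reflDist x y) / 2 := by unfold reflDist; ring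
    have hY : ‖y‖ ^ 2 = 1 - 2 * wt y := by unfold wt; ring
    simp only [D₂, α₂, Xα, Xβ, Yα, Yβ, A, B, β, ρ, N]
    rw [← hX, hW, hY, hXa, hd]
    rw [hd] at hD
    generalize reflDist x y = R at *
    generalize wt y = b at *
    obtain ⟨D, hDe⟩ : ∃ D, D = R - 4 * a * b + ε := ⟨_, rfl⟩
    have hε' : ε = D - R + 4 * a * b := by rw [hDe]; ring
    rw [← hDe] at hD ⊢
    subst hε'
    field_simp
    ring
  obtain ⟨hi, hI⟩ := integral_div_span (x := x) (v := v) (g := fun y => K * A y)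
    (α₁ := α₁) (β₁ := β₁) (α₂ := α₂) (β₂ := β₂)
    (D₁ := D₁) (D₂ := D₂)
    (γ := fun y => K * (-4 * X * (ρ y * A y) - 2 * B y - 2 * (N y * A y)))
    (δ := fun y => K * (4 * (ρ y * A y) + 2 * (N y * A y)))
    hv (fun y hy => contDiffAt_const.mul (cA y hy))
    (fun y hy => (contDiffAt_const.mul (cb y hy)).add (contDiffAt_const.mul (cρ y hy)))
    (fun y hy => contDiffAt_const.mul (cρ y hy))
    (fun y hy => (contDiffAt_const.mul ((cρ y hy).mul (cA y hy))).add
      ((contDiffAt_const.mul (cB y hy)).add (contDiffAt_const.mul ((cN y).mul (cA y hy)))))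
    (fun y hy => (contDiffAt_const.mul ((cρ y hy).mul (cA y hy))).add
      (contDiffAt_const.mul ((cN y).mul (cA y hy))))
    (fun y hy => (gA y hy).const_mul) h1 h2
  refine ⟨_, hi, hI, fun y hy => ?_⟩
  have hb := wt_pos hy
  have hR := reflDist_pos hx hy
  have hD : 0 < sqDist x y + ε := by have := sqDist_nonneg x y; positivity
  have hd : sqDist x y = reflDist x y - 4 * a * wt y := by rw [reflDist_eq]; ring
  have hW : dotE x y = (1 + X * ‖y‖ ^ 2 - reflDist x y) / 2 := by unfold reflDist; ring
  have hY : ‖y‖ ^ 2 = 1 - 2 * wt y := by unfold wt; ring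
  have hsq : 0 ≤ ∑ i, (pd i v y - v y * (Xα y * y i + Xβ y * x i)
      - (Yα y * y i + Yβ y * x i)) ^ 2 := Finset.sum_nonneg fun i _ => sq_nonneg _
  have e1 : ∑ i, (pd i v y - v y * (Xα y * y i + Xβ y * x i)
      - (Yα y * y i + Yβ y * x i)) ^ 2 = (∑ i, pd i v y ^ 2)
      + v y ^ 2 * (Xα y ^ 2 * ‖y‖ ^ 2 + 2 * Xα y * Xβ y * dotE x y + Xβ y ^ 2 * X)
      + (Yα y ^ 2 * ‖y‖ ^ 2 + 2 * Yα y * Yβ y * dotE x y + Yβ y ^ 2 * X)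
      + 2 * v y * (Xα y * Yα y * ‖y‖ ^ 2 + (Xα y * Yβ y + Xβ y * Yα y) * dotE x y
        + Xβ y * Yβ y * X)
      - 2 * ∑ i, pd i v y * (v y * (Xα y * y i + Xβ y * x i) + (Yα y * y i + Yβ y * x i)) := by
    simp only [hX, norm_sq_eq_sum, dotE, Fin.sum_univ_four]
    ring
  have e2 : Yα y ^ 2 * ‖y‖ ^ 2 + 2 * Yα y * Yβ y * dotE x y + Yβ y ^ 2 * X
      = K ^ 2 / 16 * wt y ^ 2 * N y ^ 2 * sqDist x y * ρ y ^ 5 := by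
    simp only [Yα, Yβ, A, B, ρ, N]
    rw [hW, hY, hXa, hd]
    rw [hd] at hD
    generalize reflDist x y = R at *
    generalize wt y = b at *
    field_simp
    ring
  have e3 : ∑ i, pd i v y * (2 * v y * (α₁ y * y i + β₁ y * x i) + (α₂ y * y i + β₂ y * x i)
      - (K * (-4 * X * (ρ y * A y) - 2 * B y - 2 * (N y * A y)) * y i
        + K * (4 * (ρ y * A y) + 2 * (N y * A y)) * x i))
      = ∑ i, pd i v y * (v y * (Xα y * y i + Xβ y * x i) + (Yα y * y i + Yβ y * x i)) := by
    refine Finset.sum_congr rfl fun i _ => ?_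
    simp only [α₁, β₁, α₂, β₂, Xα, Xβ, Yα, Yβ]
    ring
  have e4 : v y * (21 / 8 * K * N y * sqDist x y * ρ y ^ 3) - 3 / 2 * a * β y * ρ y * v y ^ 2
      ≤ 147 / 128 * K ^ 2 * N y ^ 2 * sqDist x y ^ 2 * ρ y ^ 5 * wt y * a⁻¹ := by
    have hβ : β y * wt y = 1 := inv_mul_cancel₀ hb.ne'
    have hρ0 : 0 < ρ y := inv_pos.mpr hR
    have hβ0 : 0 < β y := inv_pos.mpr hb
    have ha1 : a * a⁻¹ = 1 := mul_inv_cancel₀ ha0.ne'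
    have key : 0 ≤ 3 / 2 * (a * β y * ρ y) * (v y - 7 / 8 * K * N y * sqDist x y * ρ y ^ 2
        * wt y * a⁻¹) ^ 2 := by positivity
    have : 3 / 2 * (a * β y * ρ y) * (v y - 7 / 8 * K * N y * sqDist x y * ρ y ^ 2
        * wt y * a⁻¹) ^ 2 = 3 / 2 * a * β y * ρ y * v y ^ 2
        - (β y * wt y) * (a * a⁻¹) * (v y * (21 / 8 * K * N y * sqDist x y * ρ y ^ 3))
        + (β y * wt y) * (a * a⁻¹) * (147 / 128 * K ^ 2 * N y ^ 2 * sqDist x y ^ 2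
          * ρ y ^ 5 * wt y * a⁻¹) := by ring
    rw [hβ, ha1] at this
    linarith
  rw [e3]
  have e5 : -(K * wt y / reflDist x y ^ 2 / (sqDist x y + ε)) * hardyOp v y
      = -(K * A y * lapE v y + 1 / 4 * (v y * (K * ρ y ^ 2 * N y))) := by
    simp only [A, ρ, N, hardyOp]
    field_simp
  have e6 : deficit v y = ∑ i, pd i v y ^ 2 - v y ^ 2 * β y ^ 2 / 4 := by
    simp only [deficit, β]
    field_simp
  have e7 : K ^ 2 * (wt y ^ 2 * sqDist x y / (32 * reflDist x y ^ 5 * (sqDist x y + ε) ^ 2)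
          + 147 / 128 * wt y * sqDist x y ^ 2 /
            (a * reflDist x y ^ 5 * (sqDist x y + ε) ^ 2))
      = 1 / 2 * (K ^ 2 / 16 * wt y ^ 2 * N y ^ 2 * sqDist x y * ρ y ^ 5)
        + 147 / 128 * K ^ 2 * N y ^ 2 * sqDist x y ^ 2 * ρ y ^ 5 * wt y * a⁻¹ := by
    simp only [ρ, N]
    field_simp
    ring
  have e8 : 8 * ε * K * wt y ^ 2 / reflDist x y ^ 2 / (sqDist x y + ε) ^ 3
      = 8 * ε * K * A y * N y ^ 2 := by
    simp only [A, ρ, N]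
    field_simp
  have e9 : K * wt y * (sqDist x y / 2 + a + wt y) / reflDist x y ^ 3
            * (ε / (sqDist x y + ε) ^ 2)
      = ε * K * N y ^ 2 * (sqDist x y / 2 + a + wt y) * wt y * ρ y ^ 3 := by
    simp only [ρ, N]
    field_simp
  rw [e5, e6, e7, e8, e9, ← e2]
  rw [e1] at hsq
  simp only [D₁, D₂]
  linarith

lemma volume_real_ball (x : E4) {r : ℝ} (hr : 0 ≤ r) :
    (volume : Measure E4).real (Metric.ball x r) = π ^ 2 / 2 * r ^ 4 := by
  have h := InnerProductSpace.volume_ball_of_dim_even (E := E4) (k := 2) (by simp) x r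
  rw [Measure.real, h]
  simp [ENNReal.toReal_ofReal hr, Nat.factorial]
  rw [ENNReal.toReal_ofReal (by positivity)]
  ring

lemma integrable_radial {f : ℝ → ℝ} (h : IntegrableOn (fun t => t ^ 3 * f t) (Set.Ioi 0)) :
    Integrable (fun x : E4 => f ‖x‖) := by
  rw [integrable_fun_norm_addHaar volume]
  simpa using h

lemma integral_radial (f : ℝ → ℝ) :
    ∫ x : E4, f ‖x‖ = 2 * π ^ 2 * ∫ t in Set.Ioi (0 : ℝ), t ^ 3 * f t := by
  rw [integral_fun_norm_addHaar volume, volume_real_ball 0 zero_le_one]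
  simp
  ring

lemma integrableOn_of_le_inv_one_add_sq {f : ℝ → ℝ} (hf : ContinuousOn f (Set.Ioi 0))
    (h : ∀ t, 0 < t → |f t| ≤ (1 + t ^ 2)⁻¹) : IntegrableOn f (Set.Ioi 0) :=
  Integrable.mono' integrable_inv_one_add_sq.integrableOn
    (hf.aestronglyMeasurable measurableSet_Ioi)
    ((ae_restrict_iff' measurableSet_Ioi).mpr (ae_of_all _ fun t ht => h t ht))

lemma integrable_bubble : Integrable (fun z : E4 => ((1 + ‖z‖ ^ 2) ^ 3)⁻¹) := by
  refine integrable_radial (f := fun t => ((1 + t ^ 2) ^ 3)⁻¹)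
    (integrableOn_of_le_inv_one_add_sq ?_ ?_)
  · refine Continuous.continuousOn ?_
    exact (continuous_pow 3).mul (Continuous.inv₀ (by fun_prop) fun t => by positivity)
  · intro t ht
    rw [abs_of_pos (by positivity), ← div_eq_mul_inv, ← one_div,
      div_le_div_iff₀ (by positivity) (by positivity)]
    have : 0 ≤ (t - 1) ^ 2 * t ^ 2 + t ^ 4 := by positivity
    nlinarith [pow_pos ht 2, pow_pos ht 3, pow_pos ht 4, pow_pos ht 5, pow_pos ht 6,
      sq_nonneg (t - 1), mul_nonneg (pow_pos ht 4).le (sq_nonneg (t - 1))]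

lemma integral_bubble : ∫ z : E4, ((1 + ‖z‖ ^ 2) ^ 3)⁻¹ = π ^ 2 / 2 := by
  rw [integral_radial (fun t => ((1 + t ^ 2) ^ 3)⁻¹)]
  have h : ∫ t in Set.Ioi (0 : ℝ), t ^ 3 * ((1 + t ^ 2) ^ 3)⁻¹
      = 1 / 4 - (1 / 4 * (1 - (1 + (0 : ℝ) ^ 2)⁻¹) ^ 2) := by
    refine integral_Ioi_of_hasDerivAt_of_nonneg (g := fun t => 1 / 4 * (1 - (1 + t ^ 2)⁻¹) ^ 2)
      ?_ ?_ ?_ ?_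
    · refine Continuous.continuousWithinAt ?_
      have : Continuous fun t : ℝ => (1 + t ^ 2)⁻¹ :=
        Continuous.inv₀ (by fun_prop) fun t => by positivity
      fun_prop
    · intro t ht
      have h1 : HasDerivAt (fun t : ℝ => 1 + t ^ 2) (2 * t) t := by
        simpa using (hasDerivAt_pow 2 t).const_add 1
      refine ((((h1.fun_inv (by positivity)).const_sub 1).fun_pow 2).const_mul
        (1 / 4)).congr_deriv ?_
      have h3 : 1 + t ^ 2 ≠ 0 := by positivity
      have h2 : 1 - (1 + t ^ 2)⁻¹ = t ^ 2 / (1 + t ^ 2) := by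
        field_simp
        ring
      rw [h2]
      simp
      field_simp
      ring
    · intro t ht
      have : 0 < t := ht
      positivity
    · have h1 : Filter.Tendsto (fun t : ℝ => (1 + t ^ 2)⁻¹) Filter.atTop (nhds 0) :=
        Filter.Tendsto.inv_tendsto_atTop
          (Filter.tendsto_atTop_add_const_left _ 1 (Filter.tendsto_pow_atTop two_ne_zero))
      convert ((h1.const_sub 1).pow 2).const_mul (1 / 4) using 2
      norm_num
  rw [h]
  ring

/-- The radial profile dominating the remainder terms. -/
noncomputable def profile (z : E4) : ℝ :=
  ((1 + ‖z‖ ^ 2) ^ 3 * ‖z‖ ^ 2)⁻¹ + ((1 + ‖z‖ ^ 2) ^ 4)⁻¹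

lemma integrable_profile : Integrable profile := by
  refine integrable_radial (f := fun t => ((1 + t ^ 2) ^ 3 * t ^ 2)⁻¹ + ((1 + t ^ 2) ^ 4)⁻¹) ?_
  have e : Set.EqOn (fun t : ℝ => t * ((1 + t ^ 2) ^ 3)⁻¹ + t ^ 3 * ((1 + t ^ 2) ^ 4)⁻¹)
      (fun t => t ^ 3 * (((1 + t ^ 2) ^ 3 * t ^ 2)⁻¹ + ((1 + t ^ 2) ^ 4)⁻¹)) (Set.Ioi 0) := by
    intro t ht
    have : t ≠ 0 := ne_of_gt ht
    simp only
    field_simp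
  refine IntegrableOn.congr_fun (Integrable.add ?_ ?_) e measurableSet_Ioi
  all_goals refine integrableOn_of_le_inv_one_add_sq (Continuous.continuousOn ?_) ?_
  · exact continuous_id.mul (Continuous.inv₀ (by fun_prop) fun t => by positivity)
  · intro t ht
    rw [abs_of_pos (by positivity), ← div_eq_mul_inv, ← one_div,
      div_le_div_iff₀ (by positivity) (by positivity)]
    have : t ≤ (1 + t ^ 2) ^ 2 := by nlinarith [sq_nonneg (t - 1), sq_nonneg (t ^ 2)]
    nlinarith [mul_le_mul_of_nonneg_right this (by positivity : 0 ≤ 1 + t ^ 2)]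
  · exact (continuous_pow 3).mul (Continuous.inv₀ (by fun_prop) fun t => by positivity)
  · intro t ht
    rw [abs_of_pos (by positivity), ← div_eq_mul_inv, ← one_div,
      div_le_div_iff₀ (by positivity) (by positivity)]
    have h1 : t ≤ 1 + t ^ 2 := by nlinarith [sq_nonneg (t - 1)]
    have h2 : t ^ 2 ≤ (1 + t ^ 2) ^ 2 := by gcongr
    have h3 : t ^ 3 ≤ (1 + t ^ 2) ^ 3 := by gcongr
    nlinarith [mul_le_mul_of_nonneg_right h3 (by positivity : 0 ≤ 1 + t ^ 2)]

lemma integrable_sq_inv_near (ρ : ℝ) :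
    Integrable (fun z : E4 => (Set.Iio ρ).indicator (fun t => (t ^ 2)⁻¹) ‖z‖) := by
  refine integrable_radial ?_
  have e : Set.EqOn ((Set.Iio ρ).indicator fun t : ℝ => t)
      (fun t => t ^ 3 * (Set.Iio ρ).indicator (fun t => (t ^ 2)⁻¹) t) (Set.Ioi 0) := by
    intro t ht
    have : t ≠ 0 := ne_of_gt ht
    by_cases h : t ∈ Set.Iio ρ
    · simp only [Set.indicator_of_mem h]
      field_simp
    · simp only [Set.indicator_of_notMem h, mul_zero]
  refine IntegrableOn.congr_fun ?_ e measurableSet_Ioi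
  rw [IntegrableOn, integrable_indicator_iff measurableSet_Iio, IntegrableOn,
    Measure.restrict_restrict measurableSet_Iio]
  refine IntegrableOn.mono_set (t := Set.Icc 0 ρ) ?_ fun t ht => ⟨ht.2.le, ht.1.le⟩
  exact continuous_id.continuousOn.integrableOn_Icc

lemma integral_near {r : ℝ} (hr : 0 ≤ r) :
    ∫ z : E4, (Set.Iio r).indicator (fun t => (t ^ 2)⁻¹) ‖z‖ = π ^ 2 * r ^ 2 := by
  rw [integral_radial]
  have e : Set.EqOn (fun t => t ^ 3 * (Set.Iio r).indicator (fun t => (t ^ 2)⁻¹) t)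
      ((Set.Iio r).indicator fun t : ℝ => t) (Set.Ioi 0) := by
    intro t ht
    have : t ≠ 0 := ne_of_gt ht
    by_cases h : t ∈ Set.Iio r
    · simp only [Set.indicator_of_mem h]
      field_simp
    · simp only [Set.indicator_of_notMem h, mul_zero]
  rw [setIntegral_congr_fun measurableSet_Ioi e, setIntegral_indicator measurableSet_Iio,
    Set.Ioi_inter_Iio, ← integral_Ioc_eq_integral_Ioo, ← intervalIntegral.integral_of_le hr,
    integral_id]
  ring

lemma TestFn.exists_bound {φ : E4 → ℝ} (h : TestFn φ) : ∃ C, 0 ≤ C ∧ ∀ y, |φ y| ≤ C := by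
  obtain ⟨C, hC⟩ := h.smooth.continuous.bounded_above_of_compact_support h.compact
  exact ⟨C, (norm_nonneg _).trans (hC 0), hC⟩

lemma TestFn.integrable_div_sq {φ : E4 → ℝ} (h : TestFn φ) {x : E4}
    (hx : x ∈ Metric.ball (0 : E4) 1) : Integrable (fun y => φ y / ‖y - x‖ ^ 2) := by
  obtain ⟨C, hC, hb⟩ := h.exists_bound
  refine Integrable.mono' (((integrable_sq_inv_near 2).comp_sub_right x).const_mul C) ?_
    (ae_of_all _ fun y => ?_)
  · exact (h.smooth.continuous.measurable.div (by fun_prop)).aestronglyMeasurable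
  · rw [norm_div, norm_eq_abs, norm_pow, norm_norm]
    by_cases hy : y ∈ Metric.ball (0 : E4) 1
    · have : ‖y - x‖ ∈ Set.Iio (2 : ℝ) := by
        have h1 : ‖x‖ < 1 := by simpa using hx
        have h2 : ‖y‖ < 1 := by simpa using hy
        have := norm_sub_le y x
        exact lt_of_le_of_lt this (by linarith)
      rw [Set.indicator_of_mem this, div_eq_mul_inv]
      gcongr
      exact hb y
    · rw [h.eq_zero hy, abs_zero, zero_div]
      exact mul_nonneg hC (Set.indicator_nonneg (fun t _ => by positivity) _)

lemma integral_rescale (F : E4 → ℝ) (x : E4) {s : ℝ} (hs : 0 < s) :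
    ∫ y, F y = s ^ 4 * ∫ z, F (x + s • z) := by
  rw [Measure.integral_comp_smul volume (fun z => F (x + z)) s, integral_add_left_eq_self]
  simp only [finrank_euclideanSpace, Fintype.card_fin, smul_eq_mul]
  rw [abs_of_pos (by positivity)]
  field_simp

lemma norm_rescale (x z : E4) {s : ℝ} (hs : 0 < s) : ‖x + s • z - x‖ ^ 2 = s ^ 2 * ‖z‖ ^ 2 := by
  rw [add_sub_cancel_left, norm_smul, norm_of_nonneg hs.le, mul_pow]

lemma tendsto_bubble {φ : E4 → ℝ} (h : TestFn φ) (x : E4) :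
    Tendsto (fun n : ℕ => ∫ y, φ y * (8 * (1 / ((n : ℝ) + 1)) ^ 2
      / (‖y - x‖ ^ 2 + (1 / ((n : ℝ) + 1)) ^ 2) ^ 3)) atTop (𝓝 (4 * π ^ 2 * φ x)) := by
  have e : ∀ n : ℕ, ∫ y, φ y * (8 * (1 / ((n : ℝ) + 1)) ^ 2
      / (‖y - x‖ ^ 2 + (1 / ((n : ℝ) + 1)) ^ 2) ^ 3)
      = ∫ z, 8 * φ (x + (1 / ((n : ℝ) + 1)) • z) * ((1 + ‖z‖ ^ 2) ^ 3)⁻¹ := by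
    intro n
    have hs : 0 < 1 / ((n : ℝ) + 1) := by positivity
    generalize 1 / ((n : ℝ) + 1) = s at hs
    rw [integral_rescale _ x hs, ← integral_const_mul]
    refine integral_congr_ae (ae_of_all _ fun z => ?_)
    simp only [norm_rescale x z hs]
    have : s ^ 2 * ‖z‖ ^ 2 + s ^ 2 = s ^ 2 * (1 + ‖z‖ ^ 2) := by ring
    rw [this]
    have : 1 + ‖z‖ ^ 2 ≠ 0 := by positivity
    field_simp
  simp only [e]
  obtain ⟨C, hC, hb⟩ := h.exists_bound
  have e2 : 4 * π ^ 2 * φ x = ∫ z : E4, 8 * φ x * ((1 + ‖z‖ ^ 2) ^ 3)⁻¹ := by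
    rw [integral_const_mul, integral_bubble]
    ring
  rw [e2]
  have hc := h.smooth.continuous
  refine tendsto_integral_of_dominated_convergence (fun z => 8 * C * ((1 + ‖z‖ ^ 2) ^ 3)⁻¹)
    (fun n => ?_) (integrable_bubble.const_mul _) (fun n => ae_of_all _ fun z => ?_)
    (ae_of_all _ fun z => ?_)
  · refine Measurable.aestronglyMeasurable ?_
    exact (((hc.comp (by fun_prop)).measurable).const_mul 8).mul (by fun_prop)
  · rw [norm_mul, norm_mul, norm_inv, norm_of_nonneg (by norm_num : (0 : ℝ) ≤ 8),
      norm_of_nonneg (by positivity : 0 ≤ (1 + ‖z‖ ^ 2) ^ 3)]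
    gcongr
    exact hb _
  · refine Tendsto.mul_const _ (Tendsto.const_mul _ ?_)
    have h1 : Tendsto (fun n : ℕ => x + (1 / ((n : ℝ) + 1)) • z) atTop (𝓝 (x + (0 : ℝ) • z)) :=
      tendsto_const_nhds.add (tendsto_one_div_add_atTop_nhds_zero_nat.smul_const z)
    rw [zero_smul, add_zero] at h1
    exact (hc.tendsto x).comp h1

lemma tendsto_error {φ : E4 → ℝ} (h : TestFn φ) {x : E4} (hx : x ∈ Metric.ball (0 : E4) 1) :
    Tendsto (fun n : ℕ => ∫ y, φ y * ((1 / ((n : ℝ) + 1)) ^ 2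
      / (‖y - x‖ ^ 2 + (1 / ((n : ℝ) + 1)) ^ 2) ^ 2)) atTop (𝓝 0) := by
  have e2 : (0 : ℝ) = ∫ _ : E4, 0 := by simp
  rw [e2]
  have hne : ∀ᵐ y : E4, y ≠ x := by
    rw [ae_iff]
    simp
  refine tendsto_integral_of_dominated_convergence (fun y => ‖φ y / ‖y - x‖ ^ 2‖)
    (fun n => ?_) (h.integrable_div_sq hx).norm (fun n => hne.mono fun z hz => ?_)
    (hne.mono fun z hz => ?_)
  · refine Measurable.aestronglyMeasurable ?_
    exact h.smooth.continuous.measurable.mul (by fun_prop)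
  · have hd : 0 < ‖z - x‖ ^ 2 := by
      have := sub_ne_zero.mpr hz
      positivity
    rw [norm_mul, norm_div (φ z), div_eq_mul_inv ‖φ z‖]
    refine mul_le_mul_of_nonneg_left ?_ (norm_nonneg _)
    have hs : 0 < (1 / ((n : ℝ) + 1)) ^ 2 := by positivity
    generalize (1 / ((n : ℝ) + 1)) ^ 2 = s at hs
    rw [norm_of_nonneg (by positivity), norm_of_nonneg hd.le, ← one_div,
      div_le_div_iff₀ (by positivity) (by positivity)]
    nlinarith [mul_pos hs hd, pow_pos hs 2, pow_pos hd 2]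
  · have hd : ‖z - x‖ ^ 2 ≠ 0 := by
      have := sub_ne_zero.mpr hz
      positivity
    have h1 : Tendsto (fun n : ℕ => (1 / ((n : ℝ) + 1)) ^ 2) atTop (𝓝 0) := by
      simpa using (tendsto_one_div_add_atTop_nhds_zero_nat (𝕜 := ℝ)).pow 2
    have h2 := (h1.div ((h1.const_add (‖z - x‖ ^ 2)).pow 2) (by simpa using hd)).const_mul (φ z)
    simpa using h2

/-- The kernel controlling `b v` by `hardyOp v`. -/
noncomputable def kap (x y : E4) : ℝ :=
  4 * wt x ^ 3 * wt y / (π ^ 2 * reflDist x y ^ 2 * sqDist x y)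

lemma refl_bounds {a b d R : ℝ} (ha : 0 < a) (hb : 0 < b) (hd : 0 ≤ d) (hR : R = d + 4 * a * b)
    (h1 : a ^ 2 ≤ R) :
    a * b ≤ R ∧ (a ^ 2 + d) / 2 ≤ R :=
  ⟨by nlinarith [sq_nonneg (a - b)], by nlinarith [mul_pos ha hb]⟩

lemma remainder_le_profile {x y : E4} (hx : x ∈ Metric.ball (0 : E4) 1)
    (hy : y ∈ Metric.ball (0 : E4) 1) {ε : ℝ} (hε : 0 < ε) :
    (4 * wt x ^ 3 / π ^ 2) ^ 2 *
        (wt y ^ 2 * sqDist x y / (32 * reflDist x y ^ 5 * (sqDist x y + ε) ^ 2)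
          + 147 / 128 * wt y * sqDist x y ^ 2 / (wt x * reflDist x y ^ 5 * (sqDist x y + ε) ^ 2))
      ≤ 300 * ((wt x)⁻¹ ^ 4 * profile ((wt x)⁻¹ • (y - x))) := by
  have ha := wt_pos hx
  have hb := wt_pos hy
  have hd := sqDist_nonneg x y
  have hRe := reflDist_eq x y
  have h1 := sq_wt_le_reflDist hx hy
  have h2 : wt y ^ 2 ≤ reflDist x y := reflDist_symm x y ▸ sq_wt_le_reflDist hy hx
  obtain ⟨h3, h4⟩ := refl_bounds ha hb hd hRe h1
  have hR := reflDist_pos hx hy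
  have hn : ‖(wt x)⁻¹ • (y - x)‖ ^ 2 = (wt x)⁻¹ ^ 2 * sqDist x y := by
    rw [norm_smul, mul_pow, sqDist_eq, norm_of_nonneg (inv_pos.mpr ha).le]
  unfold profile
  rw [hn]
  generalize wt x = a at *
  generalize wt y = b at *
  generalize reflDist x y = R at *
  generalize sqDist x y = d at *
  have hpi : 1 ≤ π ^ 4 := one_le_pow₀ (by linarith [pi_gt_three])
  have e : a⁻¹ ^ 4 * (((1 + a⁻¹ ^ 2 * d) ^ 3 * (a⁻¹ ^ 2 * d))⁻¹ + ((1 + a⁻¹ ^ 2 * d) ^ 4)⁻¹)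
      = a ^ 4 * (((a ^ 2 + d) ^ 3 * d)⁻¹ + ((a ^ 2 + d) ^ 4)⁻¹) := by
    have h5 : 1 + a⁻¹ ^ 2 * d = (a ^ 2 + d) / a ^ 2 := by field_simp
    rw [h5]
    have : a ^ 2 + d ≠ 0 := by positivity
    field_simp
  have hD : 0 < a ^ 2 + d := by positivity
  have hR3 : (a ^ 2 + d) ^ 3 ≤ 8 * R ^ 3 := by
    have : ((a ^ 2 + d) / 2) ^ 3 ≤ R ^ 3 := by gcongr
    linarith [show ((a ^ 2 + d) / 2) ^ 3 = (a ^ 2 + d) ^ 3 / 8 by ring]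
  have hR4 : (a ^ 2 + d) ^ 4 ≤ 16 * R ^ 4 := by
    have : ((a ^ 2 + d) / 2) ^ 4 ≤ R ^ 4 := by gcongr
    linarith [show ((a ^ 2 + d) / 2) ^ 4 = (a ^ 2 + d) ^ 4 / 16 by ring]
  have t1 : a ^ 6 * (b ^ 2 * d / (R ^ 5 * (d + ε) ^ 2)) ≤
      8 * (a ^ 4 * ((a ^ 2 + d) ^ 3 * d)⁻¹) := by
    rcases hd.eq_or_lt with h0 | h0
    · simp [← h0]
    · have s1 : d / (d + ε) ^ 2 ≤ d⁻¹ := by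
        rw [← one_div, div_le_div_iff₀ (by positivity) h0]
        nlinarith [mul_pos h0 hε]
      have s2 : a ^ 2 * b ^ 2 / R ^ 2 ≤ 1 := by
        rw [div_le_one (by positivity)]
        calc a ^ 2 * b ^ 2 ≤ R * R := mul_le_mul h1 h2 (by positivity) hR.le
          _ = R ^ 2 := by ring
      have s3 : (R ^ 3)⁻¹ ≤ 8 * ((a ^ 2 + d) ^ 3)⁻¹ := by
        rw [← one_div, ← div_eq_mul_inv, div_le_div_iff₀ (by positivity) (by positivity)]
        linarith
      calc a ^ 6 * (b ^ 2 * d / (R ^ 5 * (d + ε) ^ 2))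
          = a ^ 4 * ((a ^ 2 * b ^ 2 / R ^ 2) * (R ^ 3)⁻¹ * (d / (d + ε) ^ 2)) := by field_simp
        _ ≤ a ^ 4 * (1 * (8 * ((a ^ 2 + d) ^ 3)⁻¹) * d⁻¹) := by gcongr
        _ = _ := by rw [mul_inv]; ring
  have t2 : a ^ 5 * (b * d ^ 2 / (R ^ 5 * (d + ε) ^ 2)) ≤ 16 * (a ^ 4 * ((a ^ 2 + d) ^ 4)⁻¹) := by
    have s1 : d ^ 2 / (d + ε) ^ 2 ≤ 1 := by
      rw [div_le_one (by positivity)]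
      gcongr
      linarith
    have s2 : a * b / R ≤ 1 := by rwa [div_le_one hR]
    have s3 : (R ^ 4)⁻¹ ≤ 16 * ((a ^ 2 + d) ^ 4)⁻¹ := by
      rw [← one_div, ← div_eq_mul_inv, div_le_div_iff₀ (by positivity) (by positivity)]
      linarith
    calc a ^ 5 * (b * d ^ 2 / (R ^ 5 * (d + ε) ^ 2))
        = a ^ 4 * ((a * b / R) * (R ^ 4)⁻¹ * (d ^ 2 / (d + ε) ^ 2)) := by field_simp
      _ ≤ a ^ 4 * (1 * (16 * ((a ^ 2 + d) ^ 4)⁻¹) * 1) := by gcongr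
      _ = _ := by ring
  rw [e]
  have p1 : 0 ≤ a ^ 4 * ((a ^ 2 + d) ^ 3 * d)⁻¹ := by positivity
  have p2 : 0 ≤ a ^ 4 * ((a ^ 2 + d) ^ 4)⁻¹ := by positivity
  calc _ = (π ^ 4)⁻¹ * (1 / 2 * (a ^ 6 * (b ^ 2 * d / (R ^ 5 * (d + ε) ^ 2)))
        + 147 / 8 * (a ^ 5 * (b * d ^ 2 / (R ^ 5 * (d + ε) ^ 2)))) := by
        field_simp
        ring
    _ ≤ 1 * (1 / 2 * (a ^ 6 * (b ^ 2 * d / (R ^ 5 * (d + ε) ^ 2)))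
        + 147 / 8 * (a ^ 5 * (b * d ^ 2 / (R ^ 5 * (d + ε) ^ 2)))) := by
        refine mul_le_mul_of_nonneg_right (inv_le_one_of_one_le₀ hpi) (by positivity)
    _ ≤ _ := by linarith

lemma integrable_rescaled_profile {x : E4} (hx : x ∈ Metric.ball (0 : E4) 1) :
    Integrable fun y => (wt x)⁻¹ ^ 4 * profile ((wt x)⁻¹ • (y - x)) :=
  (((integrable_profile.comp_smul (inv_pos.mpr (wt_pos hx)).ne').comp_sub_right x)).const_mul _

lemma integral_rescaled_profile {x : E4} (hx : x ∈ Metric.ball (0 : E4) 1) :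
    ∫ y, (wt x)⁻¹ ^ 4 * profile ((wt x)⁻¹ • (y - x)) = ∫ z, profile z := by
  have ha := wt_pos hx
  rw [integral_rescale _ x ha, ← integral_const_mul]
  refine integral_congr_ae (ae_of_all _ fun z => ?_)
  simp only [add_sub_cancel_left, smul_smul, inv_mul_cancel₀ ha.ne', one_smul]
  field_simp

lemma profile_nonneg (z : E4) : 0 ≤ profile z := by
  unfold profile
  positivity

lemma kap_nonneg {x y : E4} (hx : x ∈ Metric.ball (0 : E4) 1) (hy : y ∈ Metric.ball (0 : E4) 1) :
    0 ≤ kap x y := by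
  have := wt_pos hx
  have := wt_pos hy
  have := sqDist_nonneg x y
  unfold kap
  positivity

lemma contDiffAt_div_reflDist {x : E4} (hx : x ∈ Metric.ball (0 : E4) 1) {g : E4 → ℝ}
    (hg : ContDiff ℝ (⊤ : ℕ∞) g) (n : ℕ) {y : E4} (hy : y ∈ Metric.ball (0 : E4) 1) :
    ContDiffAt ℝ (⊤ : ℕ∞) (fun y => g y / reflDist x y ^ n) y :=
  hg.contDiffAt.div ((contDiff_reflDist x).contDiffAt.pow n)
    (pow_pos (reflDist_pos hx hy) n).ne'

lemma TestFn.integrable_kap_mul {x : E4} (hx : x ∈ Metric.ball (0 : E4) 1) {f : E4 → ℝ}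
    (hf : TestFn f) : IntegrableOn (fun y => kap x y * |f y|) (Metric.ball 0 1) := by
  have h := (hf.mul_right (g := fun y => (4 * wt x ^ 3 / π ^ 2 * wt y) / reflDist x y ^ 2)
    fun y hy => contDiffAt_div_reflDist hx (contDiff_const.mul contDiff_wt) 2 hy)
  refine (h.integrable_div_sq hx).norm.integrableOn.congr_fun (fun y hy => ?_) measurableSet_ball
  have hk := kap_nonneg hx hy
  simp only [norm_eq_abs]
  rw [← abs_of_nonneg hk, ← abs_mul, kap, sqDist_eq]
  congr 1
  have := (reflDist_pos hx hy).ne'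
  field_simp

lemma integrable_regularized {φ : E4 → ℝ} (h : TestFn φ) (x : E4) {ε : ℝ} (hε : 0 < ε) (c : ℝ)
    (n : ℕ) : Integrable fun y => φ y * (c / (sqDist x y + ε) ^ n) := by
  refine TestFn.integrable (h.mul_right fun y _ => ?_)
  refine contDiffAt_const.div (((contDiff_sqDist x).contDiffAt.add contDiffAt_const).pow n) ?_
  have := sqDist_nonneg x y
  positivity

lemma wt_mul_le {x : E4} (hx : x ∈ Metric.ball (0 : E4) 1) {v : E4 → ℝ} (hv : TestFn v) :
    wt x * v x ≤ (∫ y in Metric.ball (0 : E4) 1, kap x y * |hardyOp v y|)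
      + 1 / 2 * (∫ y in Metric.ball (0 : E4) 1, deficit v y) + 300 * ∫ z, profile z := by
  set K := 4 * wt x ^ 3 / π ^ 2 with hK
  have ha := wt_pos hx
  have hK0 : 0 ≤ K := by positivity
  have hφ₁ : TestFn fun y => v y * (K * wt y ^ 2 / reflDist x y ^ 2) :=
    hv.mul_right fun y hy =>
      contDiffAt_div_reflDist hx (contDiff_const.mul (contDiff_wt.pow 2)) 2 hy
  have hφ₂ : TestFn fun y => v y * (K * wt y * (sqDist x y / 2 + wt x + wt y)
      / reflDist x y ^ 3) :=
    hv.mul_right fun y hy => contDiffAt_div_reflDist hx ((contDiff_const.mul contDiff_wt).mul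
      ((((contDiff_sqDist x).div_const 2).add contDiff_const).add contDiff_wt)) 3 hy
  set φ₁ : E4 → ℝ := fun y => v y * (K * wt y ^ 2 / reflDist x y ^ 2) with hφ₁e
  set φ₂ : E4 → ℝ := fun y => v y * (K * wt y * (sqDist x y / 2 + wt x + wt y)
      / reflDist x y ^ 3) with hφ₂e
  have iκ := hv.hardyOp.integrable_kap_mul hx
  have iR := (integrable_rescaled_profile hx).integrableOn (s := Metric.ball (0 : E4) 1)
  have hne : ∀ᵐ y : E4, y ≠ x := by
    rw [ae_iff]
    simp
  have main : ∀ ε : ℝ, 0 < ε → ∫ y, φ₁ y * (8 * ε / (‖y - x‖ ^ 2 + ε) ^ 3) ≤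
      (∫ y in Metric.ball (0 : E4) 1, kap x y * |hardyOp v y|)
      - 17 / 2 * (∫ y, φ₂ y * (ε / (‖y - x‖ ^ 2 + ε) ^ 2))
      + 1 / 2 * (∫ y in Metric.ball (0 : E4) 1, deficit v y) + 300 * ∫ z, profile z := by
    intro ε hε
    simp only [← sqDist_eq]
    obtain ⟨G, iG, hG, hle⟩ := calibration_ineq hx hε K hv
    have i1 := (integrable_regularized hφ₁ x hε (8 * ε) 3).integrableOn
      (s := Metric.ball (0 : E4) 1)
    have i2 := (integrable_regularized hφ₂ x hε ε 2).integrableOn (s := Metric.ball (0 : E4) 1)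
    have i3 := hv.deficit.integrable.integrableOn (s := Metric.ball (0 : E4) 1)
    have hz : ∀ {φ : E4 → ℝ} (c : E4 → ℝ), TestFn φ →
        ∫ y in Metric.ball (0 : E4) 1, φ y * c y = ∫ y, φ y * c y := fun c hφ =>
      setIntegral_eq_integral_of_forall_compl_eq_zero fun y hy => by rw [hφ.eq_zero hy, zero_mul]
    rw [← hz _ hφ₁, ← hz _ hφ₂]
    have hp : ∫ y in Metric.ball (0 : E4) 1, (wt x)⁻¹ ^ 4 * profile ((wt x)⁻¹ • (y - x))
        ≤ ∫ z, profile z := by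
      rw [← integral_rescaled_profile hx]
      exact setIntegral_le_integral (integrable_rescaled_profile hx)
        (ae_of_all _ fun y => mul_nonneg (by positivity) (profile_nonneg _))
    have hmono := integral_mono_ae (iG.add i1)
      (((iκ.sub (i2.const_mul (17 / 2))).add (i3.const_mul (1 / 2))).add (iR.const_mul 300)) ?_
    · have s1 := integral_add iG i1
      have s2 := integral_add ((iκ.sub (i2.const_mul (17 / 2))).add (i3.const_mul (1 / 2)))
        (iR.const_mul 300)
      have s3 := integral_add (iκ.sub (i2.const_mul (17 / 2))) (i3.const_mul (1 / 2))
      have s4 := integral_sub iκ (i2.const_mul (17 / 2))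
      simp only [Pi.add_apply, Pi.sub_apply, integral_const_mul] at hmono s1 s2 s3 s4 hp
      linarith
    · refine (ae_restrict_iff' measurableSet_ball).mpr (hne.mono fun y hyx hy => ?_)
      simp only [Pi.add_apply, Pi.sub_apply]
      have l1 := hle y hy
      have l2 := remainder_le_profile hx hy hε
      rw [← hK] at l2
      have hb := wt_pos hy
      have hR := reflDist_pos hx hy
      have hd : 0 < sqDist x y := by
        have := sub_ne_zero.mpr hyx
        rw [sqDist_eq]
        positivity
      have l3 : -(K * wt y / reflDist x y ^ 2 / (sqDist x y + ε)) * hardyOp v y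
          ≤ kap x y * |hardyOp v y| := by
        have hk : K * wt y / reflDist x y ^ 2 / (sqDist x y + ε) ≤ kap x y := by
          have : kap x y = K * wt y / reflDist x y ^ 2 / sqDist x y := by
            rw [kap, hK]
            field_simp
          rw [this]
          gcongr
          linarith
        rw [neg_mul, ← mul_neg]
        refine (mul_le_mul_of_nonneg_left (neg_le_abs _) (by positivity)).trans ?_
        gcongr
      have e1 : φ₁ y * (8 * ε / (sqDist x y + ε) ^ 3)
          = v y * (8 * ε * K * wt y ^ 2 / reflDist x y ^ 2 / (sqDist x y + ε) ^ 3) := by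
        simp only [hφ₁e]
        ring
      have e2 : φ₂ y * (ε / (sqDist x y + ε) ^ 2)
          = v y * (K * wt y * (sqDist x y / 2 + wt x + wt y) / reflDist x y ^ 3
              * (ε / (sqDist x y + ε) ^ 2)) := by
        simp only [hφ₂e]
        ring
      rw [e1, e2]
      linarith
  have hval : 4 * π ^ 2 * φ₁ x = wt x * v x := by
    have hRx : reflDist x x = 4 * wt x ^ 2 := by
      rw [reflDist_eq, sqDist_eq, sub_self]
      simp
      ring
    simp only [hφ₁e, hRx, hK]
    field_simp
  rw [← hval]
  have lim := ((tendsto_error hφ₂ hx).const_mul (17 / 2)).const_sub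
    (∫ y in Metric.ball (0 : E4) 1, kap x y * |hardyOp v y|) |>.add_const
      (1 / 2 * (∫ y in Metric.ball (0 : E4) 1, deficit v y)) |>.add_const (300 * ∫ z, profile z)
  rw [mul_zero, sub_zero] at lim
  exact le_of_tendsto_of_tendsto' (tendsto_bubble hφ₁ x) lim fun n => main _ (by positivity)

lemma hardyOp_const_mul {v : E4 → ℝ} (hv : TestFn v) (c : ℝ) (y : E4) :
    hardyOp (fun z => c * v z) y = c * hardyOp v y := by
  have e : ∀ {w : E4 → ℝ}, TestFn w → ∀ i, pd i (fun z => c * w z) = fun z => c * pd i w z :=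
    fun hw i => funext fun z => by
      rw [HasPD.pd_eq (HasPD.const.mul (hw.hasPD i z)) ((hw.const_mul c).differentiableAt z)]
      ring
  simp only [hardyOp, lapE_eq, e hv, e (hv.pd _), ← Finset.mul_sum]
  ring

lemma deficit_const_mul {v : E4 → ℝ} (hv : TestFn v) (c : ℝ) (y : E4) :
    deficit (fun z => c * v z) y = c ^ 2 * deficit v y := by
  have e : ∀ i, pd i (fun z => c * v z) y = c * pd i v y := fun i => by
    rw [HasPD.pd_eq (HasPD.const.mul (hv.hasPD i y)) ((hv.const_mul c).differentiableAt y)]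
    ring
  simp only [deficit, e, mul_pow, ← Finset.mul_sum]
  ring

lemma abs_wt_mul_le {x : E4} (hx : x ∈ Metric.ball (0 : E4) 1) {v : E4 → ℝ} (hv : TestFn v)
    {t : ℝ} (ht : 0 < t) :
    t * |wt x * v x| ≤ t * (∫ y in Metric.ball (0 : E4) 1, kap x y * |hardyOp v y|)
      + t ^ 2 * (1 / 2 * ∫ y in Metric.ball (0 : E4) 1, deficit v y) + 300 * ∫ z, profile z := by
  have h : ∀ c : ℝ, |c| = t → c * (wt x * v x) ≤
      t * (∫ y in Metric.ball (0 : E4) 1, kap x y * |hardyOp v y|)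
      + t ^ 2 * (1 / 2 * ∫ y in Metric.ball (0 : E4) 1, deficit v y) + 300 * ∫ z, profile z := by
    intro c hc
    have := wt_mul_le hx (hv.const_mul c)
    simp only [hardyOp_const_mul hv, deficit_const_mul hv, abs_mul, hc, mul_left_comm _ t,
      integral_const_mul] at this
    rw [← hc, sq_abs, hc]
    linarith
  rcases abs_cases (wt x * v x) with ⟨h1, -⟩ | ⟨h1, -⟩ <;> rw [h1]
  · exact h t (abs_of_pos ht)
  · have := h (-t) (by rw [abs_neg, abs_of_pos ht])
    linarith

lemma integral_profile_pos : 0 < ∫ z, profile z := by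
  refine (integral_pos_iff_support_of_nonneg profile_nonneg integrable_profile).mpr ?_
  have : Function.support profile = Set.univ := by
    ext z
    simp only [Function.mem_support, Set.mem_univ, iff_true]
    unfold profile
    positivity
  rw [this]
  exact Measure.measure_univ_pos.mpr (NeZero.ne _)

lemma integral_deficit_nonneg {v : E4 → ℝ} (hv : TestFn v) :
    0 ≤ ∫ y in Metric.ball (0 : E4) 1, deficit v y := by
  by_contra! hneg
  set H := ∫ y in Metric.ball (0 : E4) 1, deficit v y
  have h0 : (0 : E4) ∈ Metric.ball (0 : E4) 1 := by simp
  set A := ∫ y in Metric.ball (0 : E4) 1, kap 0 y * |hardyOp v y|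
  have h : ∀ t : ℝ, 0 < t → 0 ≤ t * A + t ^ 2 * (1 / 2 * H) + 300 * ∫ z, profile z :=
    fun t ht => (by positivity : (0 : ℝ) ≤ t * |wt 0 * v 0|).trans (abs_wt_mul_le h0 hv ht)
  have hP := integral_profile_pos
  set P := ∫ z, profile z
  set t := 1 + (2 * |A| + 600 * P) / (-H) with ht
  have h1 : 1 ≤ t := by
    have : 0 ≤ (2 * |A| + 600 * P) / (-H) := div_nonneg (by positivity) (by linarith)
    linarith
  have h2 : t * H = H - (2 * |A| + 600 * P) := by
    have := hneg.ne
    rw [ht]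
    field_simp
    ring
  have h3 := h t (by linarith)
  have h4 : t * A ≤ t * |A| := by gcongr; exact le_abs_self A
  have h5 : t ^ 2 * (1 / 2 * H) = t / 2 * (H - (2 * |A| + 600 * P)) := by rw [← h2]; ring
  nlinarith [abs_nonneg A]

/-- The pointwise bound for `b v` by `hardyOp v` and the Hardy deficit. -/
lemma abs_wt_mul_le_add_sqrt {x : E4} (hx : x ∈ Metric.ball (0 : E4) 1) {v : E4 → ℝ}
    (hv : TestFn v) :
    |wt x * v x| ≤ (∫ y in Metric.ball (0 : E4) 1, kap x y * |hardyOp v y|)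
      + √(600 * (∫ z, profile z) * ∫ y in Metric.ball (0 : E4) 1, deficit v y) := by
  have hH := integral_deficit_nonneg hv
  have hP := integral_profile_pos
  have h := fun t (ht : 0 < t) => abs_wt_mul_le hx hv ht
  set H := ∫ y in Metric.ball (0 : E4) 1, deficit v y
  set A := ∫ y in Metric.ball (0 : E4) 1, kap x y * |hardyOp v y|
  set P := ∫ z, profile z
  generalize |wt x * v x| = U at *
  rcases hH.eq_or_lt with h0 | h0
  · rw [← h0] at h ⊢
    simp only [mul_zero, sqrt_zero, add_zero] at h ⊢
    refine le_of_forall_pos_le_add fun e he => ?_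
    have := h (300 * P / e) (by positivity)
    have h2 : 300 * P = 300 * P / e * e := by field_simp
    have h3 : 300 * P / e * U ≤ 300 * P / e * (A + e) := by linarith
    exact le_of_mul_le_mul_left h3 (by positivity)
  · have hs : √(600 * P * H) ^ 2 = 600 * P * H := sq_sqrt (by positivity)
    have hs0 : 0 < √(600 * P * H) := sqrt_pos.mpr (by positivity)
    set s := √(600 * P * H)
    have := h (s / H) (by positivity)
    have e1 : (s / H) ^ 2 * (1 / 2 * H) = s / H * (s / 2) := by field_simp
    have e2 : 300 * P = s / H * (s / 2) := by
      field_simp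
      linarith
    rw [e1, e2] at this
    have h3 : s / H * U ≤ s / H * (A + s) := by linarith
    exact le_of_mul_le_mul_left h3 (by positivity)

lemma abs_wt_sub_wt_le {x y : E4} (hx : x ∈ Metric.ball (0 : E4) 1)
    (hy : y ∈ Metric.ball (0 : E4) 1) : wt x - wt y ≤ ‖y - x‖ := by
  rw [mem_ball_zero_iff] at hx hy
  have h1 := norm_sub_norm_le y x
  have h2 := norm_nonneg x
  have h3 := norm_nonneg y
  have h4 := norm_nonneg (y - x)
  unfold wt
  nlinarith

lemma kap_le {x y : E4} (hx : x ∈ Metric.ball (0 : E4) 1) (hy : y ∈ Metric.ball (0 : E4) 1) :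
    kap x y ≤ (π ^ 2)⁻¹ * (‖y - x‖ ^ 2)⁻¹ := by
  have ha := wt_pos hx
  have hb := wt_pos hy
  have hR := reflDist_pos hx hy
  have h1 := sq_wt_le_reflDist hx hy
  have h2 : 4 * (wt x * wt y) ≤ reflDist x y := by
    rw [reflDist_eq]
    linarith [sqDist_nonneg x y]
  have h3 : 4 * wt x ^ 3 * wt y / reflDist x y ^ 2 ≤ 1 := by
    rw [div_le_one (by positivity)]
    calc 4 * wt x ^ 3 * wt y = wt x ^ 2 * (4 * (wt x * wt y)) := by ring
      _ ≤ reflDist x y * reflDist x y := by gcongr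
      _ = reflDist x y ^ 2 := by ring
  calc kap x y = 4 * wt x ^ 3 * wt y / reflDist x y ^ 2 * ((π ^ 2)⁻¹ * (‖y - x‖ ^ 2)⁻¹) := by
        rw [kap, sqDist_eq]
        ring
    _ ≤ 1 * ((π ^ 2)⁻¹ * (‖y - x‖ ^ 2)⁻¹) := by gcongr
    _ = _ := one_mul _

/-- The radial majorant of `(4 * π ^ 2 * kap x y) ^ 2` at distance at least `r`, with `a = wt x`. -/
noncomputable def farProfile (a r t : ℝ) : ℝ :=
  (Set.Ico r 1).indicator (fun t => (t ^ 4)⁻¹) t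
    + (15 * a⁻¹ * (Set.Iic a).indicator (fun t => (t ^ 3)⁻¹) t
      + 16 * a ^ 4 * (Set.Ioi a).indicator (fun t => (t ^ 8)⁻¹) t)

lemma farProfile_nonneg {a r t : ℝ} (ha : 0 < a) (ht : 0 ≤ t) : 0 ≤ farProfile a r t := by
  unfold farProfile Set.indicator
  positivity

lemma kap_sq_le {x y : E4} (hx : x ∈ Metric.ball (0 : E4) 1) (hy : y ∈ Metric.ball (0 : E4) 1)
    {r : ℝ} (hr : 0 < r) (h : r ≤ ‖y - x‖) :
    kap x y ^ 2 ≤ (16 * π ^ 4)⁻¹ * farProfile (wt x) r ‖y - x‖ := by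
  have ha := wt_pos hx
  have hb := wt_pos hy
  have ha2 := wt_le x
  have hR := reflDist_pos hx hy
  have hRe := reflDist_eq x y
  have hab := abs_wt_sub_wt_le hx hy
  have hd : 0 < ‖y - x‖ := hr.trans_le h
  rw [kap]
  rw [sqDist_eq] at hRe ⊢
  generalize ‖y - x‖ = d at *
  generalize wt x = a at *
  generalize wt y = b at *
  generalize reflDist x y = R at *
  have h1 : (4 * a ^ 3 * b / (π ^ 2 * R ^ 2 * d ^ 2)) ^ 2 = (16 * π ^ 4)⁻¹ *
      ((4 * a * b / R) ^ 2 * (4 * a ^ 2 / R) ^ 2 * (d ^ 4)⁻¹) := by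
    field_simp
    ring
  have h2 : 4 * a * b / R ≤ 1 := by
    rw [div_le_one hR]
    nlinarith
  have h3 : (4 * a * b / R) ^ 2 ≤ 1 := pow_le_one₀ (by positivity) h2
  have h4 : (4 * a * b / R) ^ 2 * (4 * a ^ 2 / R) ^ 2 * (d ^ 4)⁻¹
      ≤ (4 * a ^ 2 / R) ^ 2 * (d ^ 4)⁻¹ := by
    gcongr
    exact mul_le_of_le_one_left (by positivity) h3
  rw [h1]
  gcongr
  refine h4.trans ?_
  rcases le_or_gt d a with hda | hda
  · have e : farProfile a r d = (1 + 15 * (d / a)) * (d ^ 4)⁻¹ := by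
      rw [farProfile, Set.indicator_of_mem (show d ∈ Set.Ico r 1 from ⟨h, by linarith⟩),
        Set.indicator_of_mem (show d ∈ Set.Iic a from hda),
        Set.indicator_of_notMem (by simpa using hda)]
      field_simp
      ring
    rw [e]
    gcongr
    have s0 : 0 < d / a := by positivity
    have s1 : d / a ≤ 1 := (div_le_one ha).mpr hda
    have h5 : 4 * a ^ 2 / R ≤ 1 + 3 * (d / a) := by
      have h6 : (2 * a - d) ^ 2 ≤ R := by nlinarith
      rw [div_le_iff₀ hR]
      have h7 : d = a * (d / a) := by field_simp
      generalize d / a = s at *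
      have h8 : a ^ 2 * (4 + s * (1 - s) * (8 - 3 * s)) = (1 + 3 * s) * (2 * a - d) ^ 2 := by
        rw [h7]
        ring
      have h9 : 0 ≤ a ^ 2 * (s * (1 - s) * (8 - 3 * s)) :=
        mul_nonneg (by positivity) (mul_nonneg (mul_nonneg s0.le (by linarith)) (by linarith))
      nlinarith [mul_le_mul_of_nonneg_left h6 (by positivity : 0 ≤ 1 + 3 * s)]
    calc (4 * a ^ 2 / R) ^ 2 ≤ (1 + 3 * (d / a)) ^ 2 := by gcongr
      _ ≤ 1 + 15 * (d / a) := by nlinarith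
  · have h5 : 4 * a ^ 2 / R ≤ 4 * a ^ 2 / d ^ 2 := by
      gcongr
      nlinarith [mul_pos ha hb]
    have e : 16 * a ^ 4 * (d ^ 8)⁻¹ ≤ farProfile a r d := by
      rw [farProfile, Set.indicator_of_mem (show d ∈ Set.Ioi a from hda),
        Set.indicator_of_notMem (by simpa using hda : d ∉ Set.Iic a)]
      have : 0 ≤ (Set.Ico r 1).indicator (fun t => (t ^ 4)⁻¹) d := by
        unfold Set.indicator
        positivity
      linarith
    refine le_trans ?_ e
    calc (4 * a ^ 2 / R) ^ 2 * (d ^ 4)⁻¹ ≤ (4 * a ^ 2 / d ^ 2) ^ 2 * (d ^ 4)⁻¹ := by gcongr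
      _ = _ := by
        field_simp
        ring

lemma integrableOn_indicator {s : Set ℝ} (hs : MeasurableSet s) {f : ℝ → ℝ}
    (h : IntegrableOn f (Set.Ioi 0 ∩ s)) : IntegrableOn (s.indicator f) (Set.Ioi 0) := by
  rwa [IntegrableOn, integrable_indicator_iff hs, IntegrableOn, Measure.restrict_restrict hs,
    Set.inter_comm]

lemma integral_farProfile {a r : ℝ} (ha : 0 < a) (hr : 0 < r) (hr1 : r ≤ 1) :
    Integrable (fun z : E4 => farProfile a r ‖z‖) ∧
      ∫ z : E4, farProfile a r ‖z‖ = 2 * π ^ 2 * (log r⁻¹ + 19) := by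
  have e : Set.EqOn (fun t => (Set.Ico r 1).indicator (fun t => t⁻¹) t
      + (15 * a⁻¹ * (Set.Iic a).indicator (fun _ => (1 : ℝ)) t
        + 16 * a ^ 4 * (Set.Ioi a).indicator (fun t => t ^ (-5 : ℝ)) t))
      (fun t => t ^ 3 * farProfile a r t) (Set.Ioi 0) := by
    intro t ht
    have h0 : 0 < t := ht
    have h5 : t ^ (-5 : ℝ) = t ^ 3 * (t ^ 8)⁻¹ := by
      rw [rpow_neg h0.le, show (5 : ℝ) = (5 : ℕ) by norm_num, rpow_natCast]
      field_simp
    simp only [farProfile, Set.indicator, h5]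
    split_ifs <;> field_simp <;> ring
  have s1 : Set.Ioi 0 ∩ Set.Ico r 1 = Set.Ico r 1 :=
    Set.inter_eq_right.mpr fun t ht => hr.trans_le ht.1
  have s2 : Set.Ioi 0 ∩ Set.Iic a = Set.Ioc 0 a := rfl
  have s3 : Set.Ioi 0 ∩ Set.Ioi a = Set.Ioi a :=
    Set.inter_eq_right.mpr fun t (ht : a < t) => ha.trans ht
  have i1 : IntegrableOn ((Set.Ico r 1).indicator fun t => t⁻¹) (Set.Ioi 0) := by
    refine integrableOn_indicator measurableSet_Ico ?_
    rw [s1]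
    refine IntegrableOn.mono_set (ContinuousOn.integrableOn_Icc (a := r) (b := 1) ?_)
      Set.Ico_subset_Icc_self
    exact continuousOn_inv₀.mono fun t ht => (hr.trans_le ht.1).ne'
  have i2 : IntegrableOn ((Set.Iic a).indicator fun _ => (1 : ℝ)) (Set.Ioi 0) := by
    refine integrableOn_indicator measurableSet_Iic ?_
    rw [s2]
    exact integrableOn_const (by simp)
  have i3 : IntegrableOn ((Set.Ioi a).indicator fun t : ℝ => t ^ (-5 : ℝ)) (Set.Ioi 0) := by
    refine integrableOn_indicator measurableSet_Ioi ?_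
    rw [s3]
    exact integrableOn_Ioi_rpow_of_lt (by norm_num) ha
  have i23 := (i2.const_mul (15 * a⁻¹)).add (i3.const_mul (16 * a ^ 4))
  refine ⟨integrable_radial (IntegrableOn.congr_fun (i1.add i23) e measurableSet_Ioi), ?_⟩
  rw [integral_radial, ← setIntegral_congr_fun measurableSet_Ioi e]
  have a1 := integral_add i1 i23
  have a2 := integral_add (i2.const_mul (15 * a⁻¹)) (i3.const_mul (16 * a ^ 4))
  simp only [Pi.add_apply] at a1 a2
  rw [a1, a2, integral_const_mul, integral_const_mul, setIntegral_indicator measurableSet_Ico,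
    setIntegral_indicator measurableSet_Iic, setIntegral_indicator measurableSet_Ioi, s1, s2, s3,
    integral_Ioi_rpow_of_lt (by norm_num) ha, integral_Ico_eq_integral_Ioc,
    ← intervalIntegral.integral_of_le hr1, integral_inv_of_pos hr one_pos, one_div]
  have h4 : a ^ (-5 + 1 : ℝ) = (a ^ 4)⁻¹ := by
    rw [show (-5 + 1 : ℝ) = -(4 : ℕ) by norm_num, rpow_neg ha.le, rpow_natCast]
  simp [h4, ha.le]
  field_simp
  ring

/-- The part of the kernel `kap` at distance less than `r`. -/
noncomputable def kapNear (r : ℝ) (x y : E4) : ℝ≥0∞ :=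
  if ‖y - x‖ < r then ENNReal.ofReal (kap x y) else 0

/-- The part of the kernel `kap` at distance at least `r`. -/
noncomputable def kapFar (r : ℝ) (x y : E4) : ℝ≥0∞ :=
  if ‖y - x‖ < r then 0 else ENNReal.ofReal (kap x y)

lemma ofReal_kap_eq (r : ℝ) (x y : E4) :
    ENNReal.ofReal (kap x y) = kapFar r x y + kapNear r x y := by
  unfold kapFar kapNear
  split_ifs <;> simp

lemma measurable_kap : Measurable fun p : E4 × E4 => kap p.1 p.2 := by
  have hw : Measurable wt := contDiff_wt.continuous.measurable
  have hd : Measurable fun p : E4 × E4 => sqDist p.1 p.2 := by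
    simp only [sqDist_eq]
    fun_prop
  have hR : Measurable fun p : E4 × E4 => reflDist p.1 p.2 := by
    simp only [reflDist_eq]
    fun_prop
  unfold kap
  fun_prop

lemma measurableSet_near (r : ℝ) : MeasurableSet {p : E4 × E4 | ‖p.2 - p.1‖ < r} :=
  measurableSet_lt (by fun_prop) measurable_const

lemma measurable_kapNear (r : ℝ) : Measurable fun p : E4 × E4 => kapNear r p.1 p.2 :=
  Measurable.ite (measurableSet_near r) measurable_kap.ennreal_ofReal measurable_const

lemma measurable_kapFar (r : ℝ) : Measurable fun p : E4 × E4 => kapFar r p.1 p.2 :=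
  Measurable.ite (measurableSet_near r) measurable_const measurable_kap.ennreal_ofReal

lemma kapFar_le {x y : E4} (hx : x ∈ Metric.ball (0 : E4) 1) (hy : y ∈ Metric.ball (0 : E4) 1)
    {r : ℝ} (hr : 0 < r) : kapFar r x y ≤ ENNReal.ofReal ((π ^ 2 * r ^ 2)⁻¹) := by
  unfold kapFar
  split_ifs with h
  · exact zero_le
  · refine ENNReal.ofReal_le_ofReal ((kap_le hx hy).trans ?_)
    rw [mul_inv]
    push Not at h
    gcongr

lemma lintegral_kapFar_sq_le {x : E4} (hx : x ∈ Metric.ball (0 : E4) 1) {r : ℝ} (hr : 0 < r)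
    (hr1 : r ≤ 1) : ∫⁻ y in Metric.ball (0 : E4) 1, kapFar r x y ^ 2
      ≤ ENNReal.ofReal ((8 * π ^ 2)⁻¹ * (log r⁻¹ + 19)) := by
  have ha := wt_pos hx
  obtain ⟨hi, he⟩ := integral_farProfile ha hr hr1
  have hn : ∀ y, 0 ≤ (16 * π ^ 4)⁻¹ * farProfile (wt x) r ‖y - x‖ := fun y =>
    mul_nonneg (by positivity) (farProfile_nonneg ha (norm_nonneg _))
  have he2 : ∫ y, (16 * π ^ 4)⁻¹ * farProfile (wt x) r ‖y - x‖
      = (8 * π ^ 2)⁻¹ * (log r⁻¹ + 19) := by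
    rw [integral_const_mul, integral_sub_right_eq_self (fun z => farProfile (wt x) r ‖z‖), he]
    field_simp
    ring
  rw [← he2, ofReal_integral_eq_lintegral_ofReal ((hi.comp_sub_right x).const_mul _)
    (ae_of_all _ hn)]
  refine le_trans (setLIntegral_mono' measurableSet_ball fun y hy => ?_)
    (setLIntegral_le_lintegral _ _)
  unfold kapFar
  split_ifs with h
  · simp
  · rw [← ENNReal.ofReal_pow (kap_nonneg hx hy)]
    exact ENNReal.ofReal_le_ofReal (kap_sq_le hx hy hr (not_lt.mp h))

lemma kapNear_le {x y : E4} (hx : x ∈ Metric.ball (0 : E4) 1) (hy : y ∈ Metric.ball (0 : E4) 1)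
    (r : ℝ) : kapNear r x y ≤ ENNReal.ofReal
      ((π ^ 2)⁻¹ * (Set.Iio r).indicator (fun t => (t ^ 2)⁻¹) ‖y - x‖) := by
  unfold kapNear
  split_ifs with h
  · rw [Set.indicator_of_mem (show ‖y - x‖ ∈ Set.Iio r from h)]
    exact ENNReal.ofReal_le_ofReal (kap_le hx hy)
  · exact zero_le

lemma lintegral_near (x : E4) {r : ℝ} (hr : 0 ≤ r) :
    ∫⁻ y : E4, ENNReal.ofReal ((π ^ 2)⁻¹ * (Set.Iio r).indicator (fun t => (t ^ 2)⁻¹) ‖y - x‖)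
      = ENNReal.ofReal (r ^ 2) := by
  rw [← ofReal_integral_eq_lintegral_ofReal
    (((integrable_sq_inv_near r).comp_sub_right x).const_mul _)
    (ae_of_all _ fun y => mul_nonneg (by positivity) (by unfold Set.indicator; positivity)),
    integral_const_mul,
    integral_sub_right_eq_self (fun z : E4 => (Set.Iio r).indicator (fun t => (t ^ 2)⁻¹) ‖z‖),
    integral_near hr]
  congr 1
  field_simp

lemma lintegral_kapNear_le {x : E4} (hx : x ∈ Metric.ball (0 : E4) 1) {r : ℝ} (hr : 0 ≤ r) :
    ∫⁻ y in Metric.ball (0 : E4) 1, kapNear r x y ≤ ENNReal.ofReal (r ^ 2) := by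
  rw [← lintegral_near x hr]
  exact (setLIntegral_mono' measurableSet_ball fun y hy => kapNear_le hx hy r).trans
    (setLIntegral_le_lintegral _ _)

lemma lintegral_kapNear_le_left {y : E4} (hy : y ∈ Metric.ball (0 : E4) 1) {r : ℝ} (hr : 0 ≤ r)
    {E : Set E4} (hE : E ⊆ Metric.ball 0 1) (hm : MeasurableSet E) :
    ∫⁻ x in E, kapNear r x y ≤ ENNReal.ofReal (r ^ 2) := by
  rw [← lintegral_near y hr]
  refine (setLIntegral_mono' hm fun x hx => ?_).trans (setLIntegral_le_lintegral _ _)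
  rw [norm_sub_rev]
  exact kapNear_le (hE hx) hy r

lemma sq_lintegral_mul_le {α : Type*} [MeasurableSpace α] (μ : Measure α) {f g : α → ℝ≥0∞}
    (hf : AEMeasurable f μ) (hg : AEMeasurable g μ) :
    (∫⁻ a, f a * g a ∂μ) ^ 2 ≤ (∫⁻ a, f a ^ 2 ∂μ) * ∫⁻ a, g a ^ 2 ∂μ := by
  have h := ENNReal.lintegral_mul_le_Lp_mul_Lq μ
    (show (2 : ℝ).HolderConjugate 2 from Real.HolderConjugate.two_two) hf hg
  have h2 : ∀ c : ℝ≥0∞, (c ^ (1 / 2 : ℝ)) ^ 2 = c := fun c => by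
    rw [← ENNReal.rpow_natCast, ← ENNReal.rpow_mul]
    norm_num
  calc (∫⁻ a, f a * g a ∂μ) ^ 2
      ≤ ((∫⁻ a, f a ^ (2 : ℝ) ∂μ) ^ (1 / 2 : ℝ) * (∫⁻ a, g a ^ (2 : ℝ) ∂μ) ^ (1 / 2 : ℝ)) ^ 2 := by
        gcongr
        exact h
    _ = _ := by simp only [mul_pow, h2, ENNReal.rpow_two]

lemma sq_lintegral_le {α : Type*} [MeasurableSpace α] (μ : Measure α) [IsProbabilityMeasure μ]
    {f : α → ℝ≥0∞} (hf : AEMeasurable f μ) : (∫⁻ a, f a ∂μ) ^ 2 ≤ ∫⁻ a, f a ^ 2 ∂μ := by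
  simpa using sq_lintegral_mul_le μ hf (g := fun _ => 1) aemeasurable_const

lemma lintegral_kapNear_avg_le {μ : Measure E4} [IsProbabilityMeasure μ]
    (hμ : ∀ᵐ x ∂μ, x ∈ Metric.ball (0 : E4) 1) {r : ℝ} (hr : 0 < r) :
    ∫⁻ y in Metric.ball (0 : E4) 1, ∫⁻ x, kapNear r x y ∂μ ≤ ENNReal.ofReal (r ^ 2) := by
  rw [lintegral_lintegral_swap (f := fun y x => kapNear r x y)
    ((measurable_kapNear r).comp measurable_swap).aemeasurable]
  calc _ ≤ ∫⁻ _, ENNReal.ofReal (r ^ 2) ∂μ :=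
        lintegral_mono_ae (hμ.mono fun x hx => lintegral_kapNear_le hx hr.le)
    _ = _ := by simp

lemma lintegral_sq_kapFar_avg_le {μ : Measure E4} [IsProbabilityMeasure μ]
    (hμ : ∀ᵐ x ∂μ, x ∈ Metric.ball (0 : E4) 1) {r : ℝ} (hr : 0 < r) (hr1 : r ≤ 1) :
    ∫⁻ y in Metric.ball (0 : E4) 1, (∫⁻ x, kapFar r x y ∂μ) ^ 2
      ≤ ENNReal.ofReal ((8 * π ^ 2)⁻¹ * (log r⁻¹ + 19)) := by
  have hm := measurable_kapFar r
  calc _ ≤ ∫⁻ y in Metric.ball (0 : E4) 1, ∫⁻ x, kapFar r x y ^ 2 ∂μ :=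
        lintegral_mono fun y => sq_lintegral_le μ
          (hm.comp (measurable_id.prodMk measurable_const)).aemeasurable
    _ = ∫⁻ x, (∫⁻ y in Metric.ball (0 : E4) 1, kapFar r x y ^ 2) ∂μ :=
        lintegral_lintegral_swap (f := fun y x => kapFar r x y ^ 2)
          ((hm.pow_const 2).comp measurable_swap).aemeasurable
    _ ≤ ∫⁻ _, ENNReal.ofReal ((8 * π ^ 2)⁻¹ * (log r⁻¹ + 19)) ∂μ :=
        lintegral_mono_ae (hμ.mono fun x hx => lintegral_kapFar_sq_le hx hr hr1)
    _ = _ := by simp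

lemma lintegral_kapNear_cond_le {E : Set E4} (hE : E ⊆ Metric.ball 0 1) (hm : MeasurableSet E)
    {r : ℝ} (hr : 0 < r) (hv : volume E = ENNReal.ofReal (π ^ 2 / 2 * r ^ 4)) {y : E4}
    (hy : y ∈ Metric.ball (0 : E4) 1) :
    ∫⁻ x, kapNear r x y ∂volume[|E] ≤ ENNReal.ofReal (2 * (π ^ 2 * r ^ 2)⁻¹) := by
  rw [ProbabilityTheory.cond, lintegral_smul_measure, hv,
    ← ENNReal.ofReal_inv_of_pos (by positivity),
    smul_eq_mul]
  calc _ ≤ ENNReal.ofReal (π ^ 2 / 2 * r ^ 4)⁻¹ * ENNReal.ofReal (r ^ 2) := by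
        gcongr
        exact lintegral_kapNear_le_left hy hr.le hE hm
    _ = _ := by
        rw [← ENNReal.ofReal_mul (by positivity)]
        congr 1
        field_simp

lemma lintegral_avg_mul_avg_le {E : Set E4} (hE : E ⊆ Metric.ball 0 1) (hm : MeasurableSet E)
    {r : ℝ} (hr : 0 < r) (hr1 : r ≤ 1) (hv : volume E = ENNReal.ofReal (π ^ 2 / 2 * r ^ 4))
    [IsProbabilityMeasure volume[|E]]
    {μ : Measure E4} [IsProbabilityMeasure μ] (hμ : ∀ᵐ x ∂μ, x ∈ Metric.ball (0 : E4) 1) :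
    ∫⁻ y in Metric.ball (0 : E4) 1, (∫⁻ x, ENNReal.ofReal (kap x y) ∂volume[|E])
        * (∫⁻ x, ENNReal.ofReal (kap x y) ∂μ)
      ≤ ENNReal.ofReal ((8 * π ^ 2)⁻¹ * (log r⁻¹ + 19) + 4 / π ^ 2) := by
  have hE' : ∀ᵐ x ∂volume[|E], x ∈ Metric.ball (0 : E4) 1 :=
    (ProbabilityTheory.ae_cond_mem hm).mono fun x hx => hE hx
  have hlog : 0 ≤ log r⁻¹ := log_nonneg (one_le_inv_iff₀.mpr ⟨hr, hr1⟩)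
  set ρ := ENNReal.ofReal ((π ^ 2 * r ^ 2)⁻¹) with hρ
  set Φ := ENNReal.ofReal ((8 * π ^ 2)⁻¹ * (log r⁻¹ + 19)) with hΦ
  have hms : ∀ y : E4, Measurable fun x : E4 => (x, y) := fun y =>
    measurable_id.prodMk measurable_const
  have mF : ∀ ν : Measure E4, IsProbabilityMeasure ν →
      Measurable fun y => ∫⁻ x, kapFar r x y ∂ν := fun ν _ =>
    Measurable.lintegral_prod_left' (measurable_kapFar r)
  have mN : ∀ ν : Measure E4, IsProbabilityMeasure ν →
      Measurable fun y => ∫⁻ x, kapNear r x y ∂ν := fun ν _ =>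
    Measurable.lintegral_prod_left' (measurable_kapNear r)
  have split : ∀ ν : Measure E4, ∀ y, ∫⁻ x, ENNReal.ofReal (kap x y) ∂ν
      = ∫⁻ x, kapFar r x y ∂ν + ∫⁻ x, kapNear r x y ∂ν := fun ν y => by
    simp only [ofReal_kap_eq r]
    exact lintegral_add_left ((measurable_kapFar r).comp (hms y)) _
  simp only [split]
  have hFF : ∫⁻ y in Metric.ball (0 : E4) 1,
      (∫⁻ x, kapFar r x y ∂volume[|E]) * (∫⁻ x, kapFar r x y ∂μ) ≤ Φ := by
    rw [← ENNReal.pow_le_pow_left_iff two_ne_zero, sq Φ]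
    refine (sq_lintegral_mul_le _ (mF _ inferInstance).aemeasurable
      (mF _ inferInstance).aemeasurable).trans ?_
    exact mul_le_mul' (lintegral_sq_kapFar_avg_le hE' hr hr1) (lintegral_sq_kapFar_avg_le hμ hr hr1)
  have hN : ∀ ν : Measure E4, IsProbabilityMeasure ν → (∀ᵐ x ∂ν, x ∈ Metric.ball (0 : E4) 1) →
      ρ * ∫⁻ y in Metric.ball (0 : E4) 1, ∫⁻ x, kapNear r x y ∂ν ≤ ENNReal.ofReal (1 / π ^ 2) := by
    intro ν _ hν
    calc _ ≤ ρ * ENNReal.ofReal (r ^ 2) := by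
          gcongr
          exact lintegral_kapNear_avg_le hν hr
      _ = _ := by
          rw [hρ, ← ENNReal.ofReal_mul (by positivity)]
          congr 1
          field_simp
  have hF : ∀ ν : Measure E4, IsProbabilityMeasure ν → (∀ᵐ x ∂ν, x ∈ Metric.ball (0 : E4) 1) →
      ∀ y ∈ Metric.ball (0 : E4) 1, ∫⁻ x, kapFar r x y ∂ν ≤ ρ := by
    intro ν _ hν y hy
    calc _ ≤ ∫⁻ _, ρ ∂ν := lintegral_mono_ae (hν.mono fun x hx => kapFar_le hx hy hr)
      _ = ρ := by simp
  have e2 : ENNReal.ofReal (2 * (π ^ 2 * r ^ 2)⁻¹) = 2 * ρ := by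
    rw [ENNReal.ofReal_mul (by positivity)]
    simp [hρ]
  calc _ ≤ ∫⁻ y in Metric.ball (0 : E4) 1,
        ((∫⁻ x, kapFar r x y ∂volume[|E]) * (∫⁻ x, kapFar r x y ∂μ)
          + (ρ * (∫⁻ x, kapNear r x y ∂volume[|E]) + 3 * (ρ * ∫⁻ x, kapNear r x y ∂μ))) := by
        refine setLIntegral_mono' measurableSet_ball fun y hy => ?_
        have h1 := hF _ inferInstance hE' y hy
        have h2 := hF μ inferInstance hμ y hy
        have h3 := lintegral_kapNear_cond_le hE hm hr hv hy
        rw [e2] at h3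
        generalize ∫⁻ x, kapFar r x y ∂volume[|E] = A₁ at *
        generalize ∫⁻ x, kapFar r x y ∂μ = A₂ at *
        generalize ∫⁻ x, kapNear r x y ∂volume[|E] = N₁ at *
        generalize ∫⁻ x, kapNear r x y ∂μ = N₂ at *
        calc (A₁ + N₁) * (A₂ + N₂) = A₁ * A₂ + (A₂ * N₁ + (A₁ * N₂ + N₁ * N₂)) := by ring
          _ ≤ A₁ * A₂ + (ρ * N₁ + (ρ * N₂ + 2 * ρ * N₂)) := by gcongr
          _ = _ := by ring
    _ = (∫⁻ y in Metric.ball (0 : E4) 1,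
          (∫⁻ x, kapFar r x y ∂volume[|E]) * (∫⁻ x, kapFar r x y ∂μ))
        + (ρ * (∫⁻ y in Metric.ball (0 : E4) 1, ∫⁻ x, kapNear r x y ∂volume[|E])
        + 3 * (ρ * ∫⁻ y in Metric.ball (0 : E4) 1, ∫⁻ x, kapNear r x y ∂μ)) := by
        have mFF : Measurable fun y => (∫⁻ x, kapFar r x y ∂volume[|E]) * ∫⁻ x, kapFar r x y ∂μ :=
          (mF _ inferInstance).mul (mF _ inferInstance)
        rw [lintegral_add_left mFF,
          lintegral_add_left ((mN _ inferInstance).const_mul ρ),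
          lintegral_const_mul _ (mN _ inferInstance),
          lintegral_const_mul _ ((mN _ inferInstance).const_mul ρ),
          lintegral_const_mul _ (mN _ inferInstance)]
    _ ≤ Φ + (ENNReal.ofReal (1 / π ^ 2) + 3 * ENNReal.ofReal (1 / π ^ 2)) := by
        gcongr
        · exact hN _ inferInstance hE'
        · exact hN _ inferInstance hμ
    _ = _ := by
        rw [show (3 : ℝ≥0∞) = ENNReal.ofReal 3 by simp, ← ENNReal.ofReal_mul (by positivity),
          ← ENNReal.ofReal_add (by positivity) (by positivity), hΦ,
          ← ENNReal.ofReal_add (by positivity) (by positivity)]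
        congr 1
        ring

lemma ofReal_abs_le_lintegral_mul {v : E4 → ℝ} (hv : TestFn v) {x : E4}
    (hx : x ∈ Metric.ball (0 : E4) 1) :
    ENNReal.ofReal |wt x * v x| ≤ (∫⁻ y in Metric.ball (0 : E4) 1,
        ENNReal.ofReal (kap x y) * ENNReal.ofReal |hardyOp v y|)
      + ENNReal.ofReal √(600 * (∫ z, profile z) * ∫ y in Metric.ball (0 : E4) 1, deficit v y) := by
  have hn : ∀ y ∈ Metric.ball (0 : E4) 1, 0 ≤ kap x y := fun y hy => kap_nonneg hx hy
  have e : ∫⁻ y in Metric.ball (0 : E4) 1, ENNReal.ofReal (kap x y) * ENNReal.ofReal |hardyOp v y|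
      = ENNReal.ofReal (∫ y in Metric.ball (0 : E4) 1, kap x y * |hardyOp v y|) := by
    rw [ofReal_integral_eq_lintegral_ofReal (hv.hardyOp.integrable_kap_mul hx)
      ((ae_restrict_iff' measurableSet_ball).mpr (ae_of_all _ fun y hy =>
        mul_nonneg (hn y hy) (abs_nonneg _)))]
    exact setLIntegral_congr_fun measurableSet_ball fun y hy => (ENNReal.ofReal_mul (hn y hy)).symm
  rw [e, ← ENNReal.ofReal_add (setIntegral_nonneg measurableSet_ball fun y hy =>
    mul_nonneg (hn y hy) (abs_nonneg _)) (sqrt_nonneg _)]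
  exact ENNReal.ofReal_le_ofReal (abs_wt_mul_le_add_sqrt hx hv)

lemma measurable_avg_kap (μ : Measure E4) [IsProbabilityMeasure μ] :
    Measurable fun y => ∫⁻ x, ENNReal.ofReal (kap x y) ∂μ :=
  Measurable.lintegral_prod_left' measurable_kap.ennreal_ofReal

lemma lintegral_lintegral_mul_right {α β : Type*} [MeasurableSpace α] [MeasurableSpace β]
    (μ : Measure α) (ν : Measure β) [SFinite μ] [SFinite ν] {k : α → β → ℝ≥0∞} {F : β → ℝ≥0∞}
    (hk : Measurable (Function.uncurry k)) (hF : Measurable F) :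
    ∫⁻ x, (∫⁻ y, k x y * F y ∂ν) ∂μ = ∫⁻ y, (∫⁻ x, k x y ∂μ) * F y ∂ν := by
  rw [lintegral_lintegral_swap (hk.mul (hF.comp measurable_snd)).aemeasurable]
  exact lintegral_congr fun y => lintegral_mul_const _ hk.of_uncurry_right

lemma ofReal_le_lintegral_avg_mul {v : E4 → ℝ} (hv : TestFn v) {E : Set E4}
    (hE : E ⊆ Metric.ball 0 1) (hm : MeasurableSet E) [IsProbabilityMeasure volume[|E]] {l : ℝ}
    (hl : ∀ x ∈ E, l ≤ |wt x * v x|) :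
    ENNReal.ofReal l ≤ (∫⁻ y in Metric.ball (0 : E4) 1,
        (∫⁻ x, ENNReal.ofReal (kap x y) ∂volume[|E]) * ENNReal.ofReal |hardyOp v y|)
      + ENNReal.ofReal √(600 * (∫ z, profile z) * ∫ y in Metric.ball (0 : E4) 1, deficit v y) := by
  have hF : Measurable fun y => ENNReal.ofReal |hardyOp v y| :=
    hv.hardyOp.smooth.continuous.abs.measurable.ennreal_ofReal
  rw [← lintegral_lintegral_mul_right _ _ measurable_kap.ennreal_ofReal hF]
  generalize hS : ENNReal.ofReal √(600 * (∫ z, profile z) * _) = S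
  calc ENNReal.ofReal l = ∫⁻ _, ENNReal.ofReal l ∂volume[|E] := by simp
    _ ≤ ∫⁻ x, ((∫⁻ y in Metric.ball (0 : E4) 1,
        ENNReal.ofReal (kap x y) * ENNReal.ofReal |hardyOp v y|) + S) ∂volume[|E] := by
        refine lintegral_mono_ae ((ProbabilityTheory.ae_cond_mem hm).mono fun x hx => ?_)
        rw [← hS]
        exact (ENNReal.ofReal_le_ofReal (hl x hx)).trans (ofReal_abs_le_lintegral_mul hv (hE hx))
    _ = _ := by
        rw [lintegral_add_right _ measurable_const]
        simp

lemma add_le_sqrt_of_lintegral_mul {α : Type*} [MeasurableSpace α] {μ : Measure α}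
    {K₁ K₂ F : α → ℝ≥0∞} (m₁ : Measurable K₁) (m₂ : Measurable K₂) (mF : Measurable F)
    {l₁ l₂ S A₁ A₂ Γ : ℝ} (hl₁ : 0 ≤ l₁) (hl₂ : 0 ≤ l₂) (hS : 0 ≤ S) (hA₁ : 0 ≤ A₁) (hA₂ : 0 ≤ A₂)
    (b₁ : ENNReal.ofReal l₁ ≤ ∫⁻ y, K₁ y * F y ∂μ + ENNReal.ofReal S)
    (b₂ : ENNReal.ofReal l₂ ≤ ∫⁻ y, K₂ y * F y ∂μ + ENNReal.ofReal S)
    (g₁₁ : ∫⁻ y, K₁ y * K₁ y ∂μ ≤ ENNReal.ofReal A₁)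
    (g₁₂ : ∫⁻ y, K₁ y * K₂ y ∂μ ≤ ENNReal.ofReal A₁)
    (g₂₂ : ∫⁻ y, K₂ y * K₂ y ∂μ ≤ ENNReal.ofReal A₂)
    (hF : ∫⁻ y, F y ^ 2 ∂μ ≤ ENNReal.ofReal Γ) :
    l₁ + l₂ ≤ √((3 * A₁ + A₂) * Γ) + 2 * S := by
  have h1 : ∫⁻ y, (K₁ y + K₂ y) ^ 2 ∂μ ≤ ENNReal.ofReal (3 * A₁ + A₂) := by
    have e : ∀ y, (K₁ y + K₂ y) ^ 2 = K₁ y * K₁ y + (2 * (K₁ y * K₂ y) + K₂ y * K₂ y) :=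
      fun y => by ring
    have m₁₁ : Measurable fun y => K₁ y * K₁ y := m₁.mul m₁
    have m₁₂ : Measurable fun y => K₁ y * K₂ y := m₁.mul m₂
    simp only [e]
    rw [lintegral_add_left m₁₁, lintegral_add_left (m₁₂.const_mul 2), lintegral_const_mul 2 m₁₂]
    calc _ ≤ ENNReal.ofReal A₁ + (2 * ENNReal.ofReal A₁ + ENNReal.ofReal A₂) := by gcongr
      _ = _ := by
        rw [show (2 : ℝ≥0∞) = ENNReal.ofReal 2 by simp, ← ENNReal.ofReal_mul (by positivity),
          ← ENNReal.ofReal_add (by positivity) hA₂, ← ENNReal.ofReal_add hA₁ (by positivity)]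
        congr 1
        ring
  have h2 : ∫⁻ y, (K₁ y + K₂ y) * F y ∂μ ≤ ENNReal.ofReal √((3 * A₁ + A₂) * Γ) := by
    rw [← ENNReal.pow_le_pow_left_iff two_ne_zero]
    calc _ ≤ _ := sq_lintegral_mul_le μ (m₁.add m₂).aemeasurable mF.aemeasurable
      _ ≤ ENNReal.ofReal (3 * A₁ + A₂) * ENNReal.ofReal Γ := mul_le_mul' h1 hF
      _ = ENNReal.ofReal √((3 * A₁ + A₂) * Γ) ^ 2 := by
        rw [← ENNReal.ofReal_mul (by positivity), ← ENNReal.ofReal_pow (sqrt_nonneg _)]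
        rcases le_total 0 ((3 * A₁ + A₂) * Γ) with h | h
        · rw [sq_sqrt h]
        · rw [sqrt_eq_zero_of_nonpos h, ENNReal.ofReal_of_nonpos h]
          simp
  have mKF : Measurable fun y => K₁ y * F y := m₁.mul mF
  have h3 : ENNReal.ofReal (l₁ + l₂) ≤ ENNReal.ofReal (√((3 * A₁ + A₂) * Γ) + 2 * S) := by
    calc ENNReal.ofReal (l₁ + l₂) ≤ (∫⁻ y, K₁ y * F y ∂μ + ENNReal.ofReal S)
          + (∫⁻ y, K₂ y * F y ∂μ + ENNReal.ofReal S) := by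
          rw [ENNReal.ofReal_add hl₁ hl₂]
          gcongr
      _ = ∫⁻ y, (K₁ y + K₂ y) * F y ∂μ + 2 * ENNReal.ofReal S := by
          simp only [add_mul]
          rw [lintegral_add_left mKF]
          ring
      _ ≤ ENNReal.ofReal √((3 * A₁ + A₂) * Γ) + 2 * ENNReal.ofReal S := by gcongr
      _ = _ := by
          rw [show (2 : ℝ≥0∞) = ENNReal.ofReal 2 by simp, ← ENNReal.ofReal_mul (by positivity),
            ← ENNReal.ofReal_add (by positivity) (by positivity)]
  exact (ENNReal.ofReal_le_ofReal_iff (by positivity)).mp h3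

lemma add_le_of_level_sets {v : E4 → ℝ} (hv : TestFn v) {E₁ E₂ : Set E4} {r₁ r₂ l₁ l₂ : ℝ}
    (h₁ : E₁ ⊆ Metric.ball 0 1) (h₂ : E₂ ⊆ Metric.ball 0 1)
    (m₁ : MeasurableSet E₁) (m₂ : MeasurableSet E₂)
    (hr₁ : 0 < r₁) (hr₂ : 0 < r₂) (hr₁' : r₁ ≤ 1) (hr₂' : r₂ ≤ 1)
    (v₁ : volume E₁ = ENNReal.ofReal (π ^ 2 / 2 * r₁ ^ 4))
    (v₂ : volume E₂ = ENNReal.ofReal (π ^ 2 / 2 * r₂ ^ 4)) (hl₁ : 0 ≤ l₁) (hl₂ : 0 ≤ l₂)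
    (hu₁ : ∀ x ∈ E₁, l₁ ≤ |wt x * v x|) (hu₂ : ∀ x ∈ E₂, l₂ ≤ |wt x * v x|) :
    l₁ + l₂ ≤ √(((8 * π ^ 2)⁻¹ * (3 * log r₁⁻¹ + log r₂⁻¹ + 204)) *
        ∫ y in Metric.ball (0 : E4) 1, hardyOp v y ^ 2)
      + 2 * √(600 * (∫ z, profile z) * ∫ y in Metric.ball (0 : E4) 1, deficit v y) := by
  have p : ∀ {E : Set E4} {r : ℝ}, 0 < r → volume E = ENNReal.ofReal (π ^ 2 / 2 * r ^ 4) →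
      IsProbabilityMeasure volume[|E] := fun {E r} hr hE =>
    ProbabilityTheory.cond_isProbabilityMeasure_of_finite
      (by rw [hE]; exact (ENNReal.ofReal_pos.mpr (by positivity)).ne')
      (by rw [hE]; exact ENNReal.ofReal_ne_top)
  have p₁ := p hr₁ v₁
  have p₂ := p hr₂ v₂
  have a₁ : ∀ᵐ x ∂volume[|E₁], x ∈ Metric.ball (0 : E4) 1 :=
    (ProbabilityTheory.ae_cond_mem m₁).mono fun x hx => h₁ hx
  have a₂ : ∀ᵐ x ∂volume[|E₂], x ∈ Metric.ball (0 : E4) 1 :=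
    (ProbabilityTheory.ae_cond_mem m₂).mono fun x hx => h₂ hx
  have g₁₁ := lintegral_avg_mul_avg_le h₁ m₁ hr₁ hr₁' v₁ a₁
  have g₁₂ := lintegral_avg_mul_avg_le h₁ m₁ hr₁ hr₁' v₁ a₂
  have g₂₂ := lintegral_avg_mul_avg_le h₂ m₂ hr₂ hr₂' v₂ a₂
  have b₁ := ofReal_le_lintegral_avg_mul hv h₁ m₁ hu₁
  have b₂ := ofReal_le_lintegral_avg_mul hv h₂ m₂ hu₂
  have k₁ := measurable_avg_kap volume[|E₁]
  have k₂ := measurable_avg_kap volume[|E₂]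
  have hlog₁ : 0 ≤ log r₁⁻¹ := log_nonneg (one_le_inv_iff₀.mpr ⟨hr₁, hr₁'⟩)
  have hlog₂ : 0 ≤ log r₂⁻¹ := log_nonneg (one_le_inv_iff₀.mpr ⟨hr₂, hr₂'⟩)
  have hF : ∫⁻ y in Metric.ball (0 : E4) 1, ENNReal.ofReal |hardyOp v y| ^ 2
      ≤ ENNReal.ofReal (∫ y in Metric.ball (0 : E4) 1, hardyOp v y ^ 2) := by
    rw [ofReal_integral_eq_lintegral_ofReal (hv.hardyOp.pow two_ne_zero).integrable.integrableOn
      (ae_of_all _ fun y => sq_nonneg _)]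
    refine lintegral_mono fun y => ?_
    rw [← ENNReal.ofReal_pow (abs_nonneg _), sq_abs]
  have h := add_le_sqrt_of_lintegral_mul k₁ k₂
    hv.hardyOp.smooth.continuous.abs.measurable.ennreal_ofReal hl₁ hl₂ (sqrt_nonneg _)
    (by positivity) (by positivity) b₁ b₂ g₁₁ g₁₂ g₂₂ hF
  convert h using 5
  field_simp
  ring

lemma exists_near_maximizer {m : ℝ → ℝ} {C : ℝ}
    (h : ∀ a b, 1 ≤ a → 1 ≤ b → 0 < m a → 0 < m b →
      (a + b) ^ 2 ≤ C - 3 * log (m a) - log (m b)) :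
    ∃ p, 1 ≤ p ∧ ∀ t, 1 ≤ t → 0 < m t →
      t ^ 2 + log (m t) ≤ (C + 3) / 4 - 1 / 2 * (min t p * |t - p|) := by
  set S : Set ℝ := {t | 1 ≤ t ∧ 0 < m t}
  set φ : ℝ → ℝ := fun t => t ^ 2 + log (m t)
  rcases S.eq_empty_or_nonempty with h0 | h0
  · exact ⟨1, le_rfl, fun t ht hm => absurd (show t ∈ S from ⟨ht, hm⟩) (h0 ▸ Set.notMem_empty t)⟩
  · have hb : BddAbove (φ '' S) := by
      refine ⟨C / 4, ?_⟩
      rintro _ ⟨t, ⟨ht, hm⟩, rfl⟩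
      have := h t t ht ht hm hm
      simp only [φ]
      linarith
    obtain ⟨_, ⟨p, ⟨hp, hmp⟩, rfl⟩, hlt⟩ :=
      exists_lt_of_lt_csSup (h0.image φ) (sub_one_lt (sSup (φ '' S)))
    refine ⟨p, hp, fun t ht hm => ?_⟩
    have h1 : φ t ≤ φ p + 1 := by
      have := le_csSup hb ⟨t, ⟨ht, hm⟩, rfl⟩
      linarith
    simp only [φ] at h1
    rcases le_total p t with hpt | hpt
    · have h2 := h p t hp ht hmp hm
      rw [min_eq_right hpt, abs_of_nonneg (sub_nonneg.mpr hpt)]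
      nlinarith
    · have h2 := h t p ht hp hm hmp
      rw [min_eq_left hpt, abs_of_nonpos (sub_nonpos.mpr hpt)]
      nlinarith

lemma mul_exp_neg_le {t p : ℝ} (ht : 1 ≤ t) (hp : 1 ≤ p) :
    2 * t * exp (-(1 / 2 * (min t p * |t - p|)))
      ≤ 8 * (1 + t ^ 2)⁻¹ + 256 * (p * (1 + (p * (t - p)) ^ 2)⁻¹) := by
  have n1 : 0 ≤ 8 * (1 + t ^ 2)⁻¹ := by positivity
  have n2 : 0 ≤ 256 * (p * (1 + (p * (t - p)) ^ 2)⁻¹) := by positivity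
  have hexp : ∀ q : ℝ, 0 ≤ q → 1 + q ^ 2 ≤ 32 * exp (q / 4) := fun q hq => by
    have := quadratic_le_exp_of_nonneg (x := q / 4) (by positivity)
    nlinarith
  rw [exp_neg, ← div_eq_mul_inv]
  rcases le_total p t with hpt | hpt
  · rw [min_eq_right hpt, abs_of_nonneg (sub_nonneg.mpr hpt)]
    refine le_trans ?_ (le_add_of_nonneg_left n1)
    have hq : 0 ≤ p * (t - p) := mul_nonneg (by linarith) (by linarith)
    have h0 : t ≤ p * (1 + p * (t - p)) := by nlinarith
    generalize p * (t - p) = q at *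
    have h1 := hexp q hq
    have h2 : 1 + q ≤ 4 * exp (q / 4) := by linarith [add_one_le_exp (q / 4)]
    have h3 : exp (1 / 2 * q) = exp (q / 4) * exp (q / 4) := by
      rw [← exp_add]
      ring_nf
    rw [h3, ← mul_assoc, ← div_eq_mul_inv, div_le_div_iff₀ (by positivity) (by positivity)]
    calc 2 * t * (1 + q ^ 2) ≤ 2 * (p * (4 * exp (q / 4))) * (32 * exp (q / 4)) := by
          gcongr
          exact h0.trans (by gcongr)
      _ = _ := by ring
  · rw [min_eq_left hpt, abs_of_nonpos (sub_nonpos.mpr hpt)]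
    rcases le_total p (2 * t) with h2t | h2t
    · refine le_trans ?_ (le_add_of_nonneg_left n1)
      have hq : 0 ≤ p * (p - t) := mul_nonneg (by linarith) (by linarith)
      have h1 := hexp _ hq
      have h2 : exp (p * (p - t) / 4) ≤ exp (1 / 2 * (t * -(t - p))) := by
        apply exp_le_exp.mpr
        nlinarith
      rw [show (p * (t - p)) ^ 2 = (p * (p - t)) ^ 2 by ring]
      rw [← mul_assoc 256, ← div_eq_mul_inv, div_le_div_iff₀ (by positivity) (by positivity)]
      calc 2 * t * (1 + (p * (p - t)) ^ 2) ≤ 2 * p * (32 * exp (1 / 2 * (t * -(t - p)))) := by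
            gcongr
            linarith
        _ ≤ _ := by
            have : 0 < p * exp (1 / 2 * (t * -(t - p))) := by positivity
            linarith
    · refine le_trans ?_ (le_add_of_nonneg_right n2)
      have h2 : exp (t ^ 2 / 2) ≤ exp (1 / 2 * (t * -(t - p))) := by
        apply exp_le_exp.mpr
        nlinarith
      have h3 := quadratic_le_exp_of_nonneg (x := t ^ 2 / 2) (by positivity)
      rw [← div_eq_mul_inv, div_le_div_iff₀ (by positivity) (by positivity)]
      have h4 : 2 * t * (1 + t ^ 2) ≤ (1 + t ^ 2) * (1 + t ^ 2) := by
        gcongr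
        nlinarith [sq_nonneg (t - 1)]
      nlinarith

lemma integral_inv_one_add_sq_scaled {p : ℝ} (hp : 0 < p) :
    Integrable (fun t : ℝ => p * (1 + (p * (t - p)) ^ 2)⁻¹) ∧
      ∫ t : ℝ, p * (1 + (p * (t - p)) ^ 2)⁻¹ = π := by
  refine ⟨((integrable_inv_one_add_sq.comp_mul_left' hp.ne').comp_sub_right p).const_mul p, ?_⟩
  rw [integral_const_mul, integral_sub_right_eq_self (fun t => (1 + (p * t) ^ 2)⁻¹),
    Measure.integral_comp_mul_left (fun t => (1 + t ^ 2)⁻¹), integral_univ_inv_one_add_sq,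
    abs_of_pos (inv_pos.mpr hp), smul_eq_mul]
  field_simp

lemma lintegral_exp_sq_le {α : Type*} [MeasurableSpace α] {μ : Measure α} [IsFiniteMeasure μ]
    {U : α → ℝ} (hU : ∀ x, 0 ≤ U x) (mU : Measurable U) {V C : ℝ} (hV : 0 < V)
    (hμ : μ Set.univ = ENNReal.ofReal V)
    (h : ∀ a b, 1 ≤ a → 1 ≤ b → 0 < μ.real {x | a < U x} → 0 < μ.real {x | b < U x} →
      (a + b) ^ 2 ≤ C - 3 * log (μ.real {x | a < U x} / V) - log (μ.real {x | b < U x} / V)) :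
    ∫⁻ x, ENNReal.ofReal (exp (U x ^ 2)) ∂μ
      ≤ ENNReal.ofReal (V * (1 + 4 * exp 1 * π + exp ((C + 3) / 4) * (264 * π))) := by
  set m : ℝ → ℝ := fun t => μ.real {x | t < U x} / V with hm
  have hpos : ∀ t, 0 < m t → 0 < μ.real {x | t < U x} := fun t ht =>
    (div_pos_iff_of_pos_right hV).mp ht
  obtain ⟨p, hp, hpeak⟩ := exists_near_maximizer (m := m) (C := C) fun a b ha hb hma hmb =>
    h a b ha hb (hpos a hma) (hpos b hmb)
  have hm0 : ∀ t, 0 ≤ m t := fun t => by positivity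
  have hm1 : ∀ t, m t ≤ 1 := fun t => by
    rw [hm, div_le_one hV]
    have : μ.real Set.univ = V := by rw [measureReal_def, hμ, ENNReal.toReal_ofReal hV.le]
    exact this ▸ measureReal_mono (Set.subset_univ _)
  have hmm : ∀ t, μ {x | t < U x} = ENNReal.ofReal (V * m t) := fun t => by
    rw [hm, mul_div_cancel₀ _ hV.ne', ofReal_measureReal]
  set G : ℝ → ℝ := fun t => V * (4 * exp 1 * (1 + t ^ 2)⁻¹ + exp ((C + 3) / 4) *
    (8 * (1 + t ^ 2)⁻¹ + 256 * (p * (1 + (p * (t - p)) ^ 2)⁻¹))) with hG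
  obtain ⟨iS, eS⟩ := integral_inv_one_add_sq_scaled (show 0 < p by linarith)
  have i1 := (integrable_inv_one_add_sq.const_mul 8).add (iS.const_mul 256)
  have i2 := (integrable_inv_one_add_sq.const_mul (4 * exp 1)).add
    (i1.const_mul (exp ((C + 3) / 4)))
  have iG : Integrable G := i2.const_mul V
  have eG : ∫ t, G t = V * (4 * exp 1 * π + exp ((C + 3) / 4) * (264 * π)) := by
    have e1 := integral_add (integrable_inv_one_add_sq.const_mul (4 * exp 1))
      (i1.const_mul (exp ((C + 3) / 4)))
    have e2 := integral_add (integrable_inv_one_add_sq.const_mul 8) (iS.const_mul 256)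
    simp only [Pi.add_apply, integral_const_mul, eS, integral_univ_inv_one_add_sq] at e1 e2
    simp only [hG]
    rw [integral_const_mul, e1, e2]
    ring
  have nG : ∀ t, 0 ≤ G t := fun t => by positivity
  have hbound : ∀ t ∈ Set.Ioi (0 : ℝ),
      μ {x | t < U x} * ENNReal.ofReal (2 * t * exp (t ^ 2)) ≤ ENNReal.ofReal (G t) := by
    intro t ht
    have ht0 : 0 < t := ht
    rw [hmm, ← ENNReal.ofReal_mul (mul_nonneg hV.le (hm0 t)), mul_assoc]
    refine ENNReal.ofReal_le_ofReal (mul_le_mul_of_nonneg_left ?_ hV.le)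
    rcases lt_or_ge t 1 with h1 | h1
    · have h2 : m t * (2 * t * exp (t ^ 2)) ≤ 1 * (2 * t * exp 1) := by
        gcongr
        · exact hm1 t
        · nlinarith
      have h3 : 2 * t * exp 1 ≤ 4 * exp 1 * (1 + t ^ 2)⁻¹ := by
        rw [← div_eq_mul_inv, le_div_iff₀ (by positivity)]
        have : t * (1 + t ^ 2) ≤ 2 := by nlinarith
        nlinarith [exp_pos 1]
      have : 0 ≤ exp ((C + 3) / 4) *
        (8 * (1 + t ^ 2)⁻¹ + 256 * (p * (1 + (p * (t - p)) ^ 2)⁻¹)) := by positivity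
      linarith
    · refine le_trans ?_ (le_add_of_nonneg_left (by positivity))
      rcases (hm0 t).eq_or_lt with h0 | h0
      · rw [← h0, zero_mul]
        positivity
      · have h2 := exp_le_exp.mpr (hpeak t h1 h0)
        rw [sub_eq_add_neg, exp_add, exp_add, exp_log h0] at h2
        calc m t * (2 * t * exp (t ^ 2)) = 2 * t * (exp (t ^ 2) * m t) := by ring
          _ ≤ 2 * t * (exp ((C + 3) / 4) * exp (-(1 / 2 * (min t p * |t - p|)))) := by gcongr
          _ = exp ((C + 3) / 4) * (2 * t * exp (-(1 / 2 * (min t p * |t - p|)))) := by ring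
          _ ≤ _ := by
            gcongr
            exact mul_exp_neg_le h1 hp
  have hcont : Continuous fun t : ℝ => 2 * t * exp (t ^ 2) := by fun_prop
  have hprim : ∀ s : ℝ, ∫ t in (0 : ℝ)..s, 2 * t * exp (t ^ 2) = exp (s ^ 2) - 1 := fun s => by
    have hd : ∀ t ∈ Set.uIcc 0 s, HasDerivAt (fun t : ℝ => exp (t ^ 2)) (2 * t * exp (t ^ 2)) t :=
      fun t _ => by
        convert (hasDerivAt_pow 2 t).exp using 1
        simp
        ring
    rw [intervalIntegral.integral_eq_sub_of_hasDerivAt hd (hcont.intervalIntegrable _ _)]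
    simp
  have hcake := lintegral_comp_eq_lintegral_meas_lt_mul μ (ae_of_all _ hU) mU.aemeasurable
    (g := fun t => 2 * t * exp (t ^ 2)) (fun t _ => hcont.intervalIntegrable _ _)
    ((ae_restrict_iff' measurableSet_Ioi).mpr (ae_of_all _ fun t (ht : 0 < t) => by positivity))
  simp only [hprim] at hcake
  calc ∫⁻ x, ENNReal.ofReal (exp (U x ^ 2)) ∂μ
      = ∫⁻ x, (ENNReal.ofReal (exp (U x ^ 2) - 1) + 1) ∂μ := by
        refine lintegral_congr fun x => ?_
        rw [← ENNReal.ofReal_one, ← ENNReal.ofReal_add _ zero_le_one, sub_add_cancel]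
        exact sub_nonneg.mpr (one_le_exp (sq_nonneg _))
    _ = (∫⁻ t in Set.Ioi 0, μ {x | t < U x} * ENNReal.ofReal (2 * t * exp (t ^ 2)))
          + ENNReal.ofReal V := by
        rw [lintegral_add_right _ measurable_const, hcake]
        simp [hμ]
    _ ≤ ENNReal.ofReal (∫ t, G t) + ENNReal.ofReal V := by
        gcongr
        rw [ofReal_integral_eq_lintegral_ofReal iG (ae_of_all _ nG)]
        exact (setLIntegral_mono' measurableSet_Ioi hbound).trans (setLIntegral_le_lintegral _ _)
    _ = _ := by
        rw [← ENNReal.ofReal_add (integral_nonneg nG) hV.le, eG]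
        congr 1
        ring

lemma sq_le_of_le_sqrt_add {s g P Γ H : ℝ} (hs : 0 ≤ s) (hg : 0 ≤ g) (hP : 0 ≤ P) (hΓ : 0 ≤ Γ)
    (hH : 0 ≤ H) (hE : Γ + 5 / 2 * H ≤ 1) (h : s ≤ √(g * Γ) + 2 * √(600 * P * H)) :
    s ^ 2 ≤ g + 960 * P := by
  have hX : √(g * Γ) ^ 2 = g * Γ := sq_sqrt (by positivity)
  have hY : √(600 * P * H) ^ 2 = 600 * P * H := sq_sqrt (by positivity)
  have hX0 := sqrt_nonneg (g * Γ)
  have hY0 := sqrt_nonneg (600 * P * H)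
  generalize √(g * Γ) = X at *
  generalize √(600 * P * H) = Y at *
  have h1 : 4 * X * Y ≤ 5 / 2 * (g * H) + 960 * (P * Γ) := by
    refine le_of_sq_le_sq ?_ (by positivity)
    calc (4 * X * Y) ^ 2 = 16 * (X ^ 2 * Y ^ 2) := by ring
      _ = 4 * (5 / 2 * (g * H)) * (960 * (P * Γ)) := by rw [hX, hY]; ring
      _ ≤ _ := by linarith [sq_nonneg (5 / 2 * (g * H) - 960 * (P * Γ))]
  calc s ^ 2 ≤ (X + 2 * Y) ^ 2 := by gcongr
    _ = X ^ 2 + 4 * X * Y + 4 * Y ^ 2 := by ring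
    _ ≤ (g + 960 * P) * (Γ + 5 / 2 * H) := by rw [hX, hY]; linarith
    _ ≤ (g + 960 * P) * 1 := by gcongr
    _ = _ := mul_one _

lemma sq_add_le_of_level_sets {v : E4 → ℝ} (hv : TestFn v)
    (hE : (∫ x in Metric.ball (0 : E4) 1, hardyOp v x ^ 2)
        + 5 / 2 * ∫ x in Metric.ball (0 : E4) 1, deficit v x ≤ 1)
    {E₁ E₂ : Set E4} {a b : ℝ} (h₁ : E₁ ⊆ Metric.ball 0 1) (h₂ : E₂ ⊆ Metric.ball 0 1)
    (m₁ : MeasurableSet E₁) (m₂ : MeasurableSet E₂)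
    (v₁ : 0 < volume.real E₁) (v₂ : 0 < volume.real E₂) (ha : 0 ≤ a) (hb : 0 ≤ b)
    (hu₁ : ∀ x ∈ E₁, a ≤ √(32 * π ^ 2) * |wt x * v x|)
    (hu₂ : ∀ x ∈ E₂, b ≤ √(32 * π ^ 2) * |wt x * v x|) :
    (a + b) ^ 2 ≤ (816 + 30720 * π ^ 2 * ∫ z, profile z)
      - 3 * log (volume.real E₁ / (π ^ 2 / 2)) - log (volume.real E₂ / (π ^ 2 / 2)) := by
  have hrad : ∀ E : Set E4, E ⊆ Metric.ball 0 1 → 0 < volume.real E → ∃ r : ℝ, 0 < r ∧ r ≤ 1 ∧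
      volume E = ENNReal.ofReal (π ^ 2 / 2 * r ^ 4) ∧
      log (volume.real E / (π ^ 2 / 2)) = -4 * log r⁻¹ := by
    intro E hEB hpos
    have hle : volume.real E ≤ π ^ 2 / 2 := by
      have := measureReal_mono hEB (μ := (volume : Measure E4)) measure_ball_lt_top.ne
      rwa [volume_real_ball 0 zero_le_one, one_pow, mul_one] at this
    have hq : 0 < volume.real E / (π ^ 2 / 2) := by positivity
    have hr4 : ((volume.real E / (π ^ 2 / 2)) ^ (1 / 4 : ℝ)) ^ 4 = volume.real E / (π ^ 2 / 2) := by
      rw [← rpow_natCast, ← rpow_mul hq.le]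
      norm_num
    refine ⟨(volume.real E / (π ^ 2 / 2)) ^ (1 / 4 : ℝ), by positivity,
      rpow_le_one hq.le ((div_le_one (by positivity)).mpr hle) (by norm_num), ?_, ?_⟩
    · rw [hr4, mul_div_cancel₀ _ (by positivity),
        ofReal_measureReal (measure_ne_top_of_subset hEB measure_ball_lt_top.ne)]
    · rw [log_inv, log_rpow hq]
      ring
  obtain ⟨r₁, hr₁, hr₁', e₁, l₁⟩ := hrad E₁ h₁ v₁
  obtain ⟨r₂, hr₂, hr₂', e₂, l₂⟩ := hrad E₂ h₂ v₂
  have hβ : 0 < √(32 * π ^ 2) := sqrt_pos.mpr (by positivity)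
  have hlog₁ : 0 ≤ log r₁⁻¹ := log_nonneg (one_le_inv_iff₀.mpr ⟨hr₁, hr₁'⟩)
  have hlog₂ : 0 ≤ log r₂⁻¹ := log_nonneg (one_le_inv_iff₀.mpr ⟨hr₂, hr₂'⟩)
  have h := add_le_of_level_sets hv h₁ h₂ m₁ m₂ hr₁ hr₂ hr₁' hr₂' e₁ e₂
    (div_nonneg ha hβ.le) (div_nonneg hb hβ.le)
    (fun x hx => (div_le_iff₀' hβ).mpr (hu₁ x hx)) (fun x hx => (div_le_iff₀' hβ).mpr (hu₂ x hx))
  have h2 := sq_le_of_le_sqrt_add (by positivity) (by positivity) integral_profile_pos.le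
    (integral_nonneg fun y => sq_nonneg _) (integral_deficit_nonneg hv) hE h
  rw [← add_div, div_pow, sq_sqrt (by positivity), div_le_iff₀ (by positivity)] at h2
  rw [l₁, l₂]
  refine h2.trans_eq ?_
  field_simp
  ring

theorem hardy_adams_exp :
    ∃ C : ℝ, 0 < C ∧ ∀ u : E4 → ℝ, ContDiff ℝ (⊤ : ℕ∞) u → HasCompactSupport u →
      tsupport u ⊆ Metric.ball (0 : E4) 1 →
      (∫ x in Metric.ball (0 : E4) 1, |lapE u x| ^ 2)
        - 9 * (∫ x in Metric.ball (0 : E4) 1, u x ^ 2 / (1 - ‖x‖ ^ 2) ^ 4) ≤ 1 →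
      (∫ x in Metric.ball (0 : E4) 1, Real.exp (32 * π ^ 2 * u x ^ 2)) ≤ C := by
  set C₀ := 816 + 30720 * π ^ 2 * ∫ z, profile z with hC₀
  refine ⟨π ^ 2 / 2 * (1 + 4 * exp 1 * π + exp ((C₀ + 3) / 4) * (264 * π)), by positivity,
    fun u h₁ h₂ h₃ hu => ?_⟩
  have hT : TestFn u := ⟨h₁, h₂, h₃⟩
  have hv := hT.div_wt
  have huv : u = fun z => wt z * (u z / wt z) := by
    funext z
    by_cases hz : z ∈ Metric.ball (0 : E4) 1
    · exact (mul_div_cancel₀ _ (wt_pos hz).ne').symm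
    · simp [hT.eq_zero hz]
  have hE : (∫ x in Metric.ball (0 : E4) 1, hardyOp (fun z => u z / wt z) x ^ 2)
      + 5 / 2 * ∫ x in Metric.ball (0 : E4) 1, deficit (fun z => u z / wt z) x ≤ 1 := by
    rw [← energy_identity hv, ← huv]
    simpa only [← congrFun huv] using hu
  have hcu : Continuous u := h₁.continuous
  have hmU : Measurable fun x => √(32 * π ^ 2) * |u x| := by fun_prop
  have hvol : (volume.restrict (Metric.ball (0 : E4) 1)) Set.univ
      = ENNReal.ofReal (π ^ 2 / 2) := by
    rw [Measure.restrict_apply_univ, ← ofReal_measureReal measure_ball_lt_top.ne,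
      volume_real_ball 0 zero_le_one, one_pow, mul_one]
  have : IsFiniteMeasure (volume.restrict (Metric.ball (0 : E4) 1)) :=
    isFiniteMeasure_restrict.mpr measure_ball_lt_top.ne
  have key := lintegral_exp_sq_le (μ := volume.restrict (Metric.ball (0 : E4) 1)) (C := C₀)
    (fun x => by positivity) hmU (by positivity) hvol fun a b ha hb hma hmb => by
      have hr : ∀ t, (volume.restrict (Metric.ball (0 : E4) 1)).real
          {x | t < √(32 * π ^ 2) * |u x|}
          = volume.real ({x | t < √(32 * π ^ 2) * |u x|} ∩ Metric.ball 0 1) := fun t =>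
        measureReal_restrict_apply (measurableSet_lt measurable_const hmU)
      have hm : ∀ t, MeasurableSet ({x | t < √(32 * π ^ 2) * |u x|} ∩ Metric.ball 0 1) := fun t =>
        (measurableSet_lt measurable_const hmU).inter measurableSet_ball
      rw [hr] at hma hmb ⊢
      rw [hr]
      refine sq_add_le_of_level_sets hv hE Set.inter_subset_right Set.inter_subset_right
        (hm a) (hm b) hma hmb (by linarith) (by linarith) (fun x hx => ?_) (fun x hx => ?_)
      all_goals
        rw [← congrFun huv x]
        exact le_of_lt hx.1
  have e : ∀ x, (√(32 * π ^ 2) * |u x|) ^ 2 = 32 * π ^ 2 * u x ^ 2 := fun x => by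
    rw [mul_pow, sq_abs, sq_sqrt (by positivity)]
  simp only [e] at key
  rw [integral_eq_lintegral_of_nonneg_ae (ae_of_all _ fun x => (exp_pos _).le)
    (by fun_prop)]
  exact ENNReal.toReal_le_of_le_ofReal (by positivity) key
end

section
/- For every ρ > 0, (1/(4√2 π²)) ∫_ρ^∞ cosh r / (sinh² r · √(cosh r − cosh ρ)) dr ≤ 1/(4π² cosh(ρ/2) sinh² ρ) + 1/(4π² cosh(ρ/2) sinh ρ). -/
open MeasureTheory Real

/-- A primitive, vanishing at `r = ρ`, of a function dominating the integrand of the kernel. -/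
noncomputable def kernelPrimitive (ρ r : ℝ) : ℝ :=
  √(2 - 2 * (sinh (ρ / 2) / sinh (r / 2)) ^ 2) / (4 * sinh (ρ / 2) ^ 2 * cosh (ρ / 2)) +
    √(2 - 2 * (cosh (ρ / 2) / cosh (r / 2)) ^ 2) / (4 * sinh (ρ / 2) * cosh (ρ / 2) ^ 2)

/-- The derivative of `kernelPrimitive`. -/
noncomputable def kernelMajorant (ρ r : ℝ) : ℝ :=
  (cosh (r / 2) / (4 * sinh (r / 2) ^ 2 * cosh (ρ / 2)) +
    sinh (r / 2) / (4 * cosh (r / 2) ^ 2 * sinh (ρ / 2))) / √(cosh r - cosh ρ)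

theorem Real.cosh_eq_one_add_two_mul_sinh_half_sq (x : ℝ) : cosh x = 1 + 2 * sinh (x / 2) ^ 2 := by
  have h := cosh_two_mul (x / 2)
  rw [mul_div_cancel₀ x two_ne_zero, cosh_sq] at h
  linarith

theorem Real.sinh_eq_two_mul_sinh_half_mul_cosh_half (x : ℝ) :
    sinh x = 2 * sinh (x / 2) * cosh (x / 2) := by
  rw [← sinh_two_mul, mul_div_cancel₀ x two_ne_zero]

theorem hasDerivAt_kernelPrimitive {ρ r : ℝ} (hρ : 0 < ρ) (hr : ρ < r) :
    HasDerivAt (kernelPrimitive ρ) (kernelMajorant ρ r) r := by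
  have hs : 0 < sinh (ρ / 2) := sinh_pos_iff.2 (by linarith)
  have hS : 0 < sinh (r / 2) := sinh_pos_iff.2 (by linarith)
  have hc : 0 < cosh (ρ / 2) := cosh_pos _
  have hC : 0 < cosh (r / 2) := cosh_pos _
  have hlt : cosh ρ < cosh r := cosh_lt_cosh.2 (by rwa [abs_of_pos hρ, abs_of_pos (hρ.trans hr)])
  have hD : 0 < √(cosh r - cosh ρ) := sqrt_pos.2 (sub_pos.2 hlt)
  have hdiff := cosh_eq_one_add_two_mul_sinh_half_sq r
  have hdiff' := cosh_eq_one_add_two_mul_sinh_half_sq ρ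
  have e1 : 2 - 2 * (sinh (ρ / 2) / sinh (r / 2)) ^ 2 =
      (cosh r - cosh ρ) / sinh (r / 2) ^ 2 := by
    rw [hdiff, hdiff']; field_simp; ring
  have e2 : 2 - 2 * (cosh (ρ / 2) / cosh (r / 2)) ^ 2 =
      (cosh r - cosh ρ) / cosh (r / 2) ^ 2 := by
    rw [hdiff, hdiff', sinh_sq, sinh_sq]; field_simp; ring
  have hhalf : HasDerivAt (fun x : ℝ => x / 2) (1 / 2) r := (hasDerivAt_id r).div_const 2
  have d1 := (((((hasDerivAt_const r (sinh (ρ / 2))).div hhalf.sinh hS.ne').pow 2).const_mul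
    2).const_sub 2).sqrt (by
      simp only [Pi.pow_apply, Pi.div_apply]
      rw [e1]; exact (div_pos (sub_pos.2 hlt) (by positivity)).ne')
  have d2 := (((((hasDerivAt_const r (cosh (ρ / 2))).div hhalf.cosh hC.ne').pow 2).const_mul
    2).const_sub 2).sqrt (by
      simp only [Pi.pow_apply, Pi.div_apply]
      rw [e2]; exact (div_pos (sub_pos.2 hlt) (by positivity)).ne')
  refine ((d1.div_const (4 * sinh (ρ / 2) ^ 2 * cosh (ρ / 2))).add
    (d2.div_const (4 * sinh (ρ / 2) * cosh (ρ / 2) ^ 2))).congr_deriv ?_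
  simp only [Pi.pow_apply, Pi.div_apply, Nat.reduceSub, pow_one]
  rw [e1, e2, sqrt_div' _ (sq_nonneg _), sqrt_div' _ (sq_nonneg _), sqrt_sq hS.le, sqrt_sq hC.le,
    kernelMajorant]
  field_simp
  ring

theorem continuousWithinAt_kernelPrimitive {ρ : ℝ} (hρ : 0 < ρ) :
    ContinuousWithinAt (kernelPrimitive ρ) (Set.Ici ρ) ρ := by
  have hs : 0 < sinh (ρ / 2) := sinh_pos_iff.2 (by linarith)
  have hc : 0 < cosh (ρ / 2) := cosh_pos _
  apply ContinuousAt.continuousWithinAt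
  unfold kernelPrimitive
  have h1 : ContinuousAt (fun r : ℝ => sinh (r / 2)) ρ := by fun_prop
  have h2 : ContinuousAt (fun r : ℝ => cosh (r / 2)) ρ := by fun_prop
  have h3 := (continuousAt_const (y := sinh (ρ / 2))).div h1 hs.ne'
  have h4 := (continuousAt_const (y := cosh (ρ / 2))).div h2 hc.ne'
  exact ((continuousAt_const.sub (continuousAt_const.mul (h3.pow 2))).sqrt.div_const _).add
    ((continuousAt_const.sub (continuousAt_const.mul (h4.pow 2))).sqrt.div_const _)

theorem Real.tendsto_sinh_atTop : Filter.Tendsto sinh Filter.atTop Filter.atTop :=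
  Filter.tendsto_atTop_mono' _ ((Filter.eventually_ge_atTop 0).mono fun _ hx => self_le_sinh_iff.2 hx)
    Filter.tendsto_id

theorem Real.tendsto_cosh_atTop : Filter.Tendsto cosh Filter.atTop Filter.atTop :=
  Filter.tendsto_atTop_mono (fun x => (sinh_lt_cosh x).le) tendsto_sinh_atTop

theorem tendsto_kernelPrimitive (ρ : ℝ) :
    Filter.Tendsto (kernelPrimitive ρ) Filter.atTop
      (nhds (√2 / (4 * sinh (ρ / 2) ^ 2 * cosh (ρ / 2)) +
        √2 / (4 * sinh (ρ / 2) * cosh (ρ / 2) ^ 2))) := by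
  have hhalf : Filter.Tendsto (fun r : ℝ => r / 2) Filter.atTop Filter.atTop :=
    Filter.tendsto_id.atTop_div_const two_pos
  have key {f : ℝ → ℝ} (hf : Filter.Tendsto f Filter.atTop Filter.atTop) (a : ℝ) :
      Filter.Tendsto (fun r => √(2 - 2 * (a / f (r / 2)) ^ 2)) Filter.atTop (nhds √2) := by
    have h := ((((hf.comp hhalf).const_div_atTop a).pow 2).const_mul 2).const_sub 2
    simpa using h.sqrt
  exact ((key tendsto_sinh_atTop _).div_const _).add ((key tendsto_cosh_atTop _).div_const _)

theorem kernel_le_kernelMajorant {ρ r : ℝ} (hρ : 0 < ρ) (hr : ρ < r) :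
    cosh r / (sinh r ^ 2 * √(cosh r - cosh ρ)) ≤ kernelMajorant ρ r := by
  have hs : 0 < sinh (ρ / 2) := sinh_pos_iff.2 (by linarith)
  have hS : 0 < sinh (r / 2) := sinh_pos_iff.2 (by linarith)
  have hc : 0 < cosh (ρ / 2) := cosh_pos _
  have hC : 0 < cosh (r / 2) := cosh_pos _
  have hsS : sinh (ρ / 2) ≤ sinh (r / 2) := sinh_le_sinh.2 (by linarith)
  have hcC : cosh (ρ / 2) ≤ cosh (r / 2) :=
    cosh_le_cosh.2 (by rw [abs_of_pos, abs_of_pos] <;> linarith)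
  rw [kernelMajorant, ← div_div]
  refine div_le_div_of_nonneg_right ?_ (sqrt_nonneg _)
  have hcosh : cosh r = cosh (r / 2) ^ 2 + sinh (r / 2) ^ 2 := by
    rw [← cosh_two_mul, mul_div_cancel₀ r two_ne_zero]
  calc cosh r / sinh r ^ 2
      = cosh (r / 2) / (4 * sinh (r / 2) ^ 2 * cosh (r / 2)) +
        sinh (r / 2) / (4 * cosh (r / 2) ^ 2 * sinh (r / 2)) := by
        rw [sinh_eq_two_mul_sinh_half_mul_cosh_half, hcosh]; field_simp; ring
    _ ≤ _ := by gcongr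

/-- The integral in the Green kernel is bounded by the limit of `kernelPrimitive` at infinity. -/
theorem integral_kernel_le {ρ : ℝ} (hρ : 0 < ρ) :
    ∫ r in Set.Ioi ρ, cosh r / (sinh r ^ 2 * √(cosh r - cosh ρ)) ≤
      √2 / (4 * sinh (ρ / 2) ^ 2 * cosh (ρ / 2)) + √2 / (4 * sinh (ρ / 2) * cosh (ρ / 2) ^ 2) := by
  have hnonneg (r : ℝ) : 0 ≤ cosh r / (sinh r ^ 2 * √(cosh r - cosh ρ)) :=
    div_nonneg (cosh_pos r).le (by positivity)
  have hcont := continuousWithinAt_kernelPrimitive hρ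
  have hderiv (r : ℝ) (hr : r ∈ Set.Ioi ρ) := hasDerivAt_kernelPrimitive hρ hr
  have hpos (r : ℝ) (hr : r ∈ Set.Ioi ρ) : 0 ≤ kernelMajorant ρ r :=
    (hnonneg r).trans (kernel_le_kernelMajorant hρ hr)
  have hlim := tendsto_kernelPrimitive ρ
  have hzero : kernelPrimitive ρ ρ = 0 := by
    have hs : sinh (ρ / 2) ≠ 0 := (sinh_pos_iff.2 (by linarith)).ne'
    simp [kernelPrimitive, div_self hs, div_self (cosh_pos (ρ / 2)).ne']
  calc _ ≤ ∫ r in Set.Ioi ρ, kernelMajorant ρ r :=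
        integral_mono_of_nonneg (.of_forall hnonneg)
          (integrableOn_Ioi_deriv_of_nonneg hcont hderiv hpos hlim)
          ((ae_restrict_mem measurableSet_Ioi).mono fun r hr => kernel_le_kernelMajorant hρ hr)
    _ = _ := by rw [integral_Ioi_of_hasDerivAt_of_nonneg hcont hderiv hpos hlim, hzero, sub_zero]

theorem green_kernel_estimate (ρ : ℝ) (hρ : 0 < ρ) :
    (1 / (4 * Real.sqrt 2 * π ^ 2)) *
        (∫ r in Set.Ioi ρ,
          Real.cosh r / (Real.sinh r ^ 2 * Real.sqrt (Real.cosh r - Real.cosh ρ)))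
      ≤ 1 / (4 * π ^ 2 * Real.cosh (ρ / 2) * Real.sinh ρ ^ 2)
        + 1 / (4 * π ^ 2 * Real.cosh (ρ / 2) * Real.sinh ρ) := by
  refine (mul_le_mul_of_nonneg_left (integral_kernel_le hρ) (by positivity)).trans ?_
  have hs : 0 < sinh (ρ / 2) := sinh_pos_iff.2 (by linarith)
  have hc : 0 < cosh (ρ / 2) := cosh_pos _
  have hsc : sinh (ρ / 2) < cosh (ρ / 2) := sinh_lt_cosh _
  rw [sinh_eq_two_mul_sinh_half_mul_cosh_half ρ]
  set s := sinh (ρ / 2)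
  set c := cosh (ρ / 2)
  have hcs : c ^ 2 = s ^ 2 + 1 := cosh_sq _
  calc _ = (c * (c + s)) / (16 * π ^ 2 * s ^ 2 * c ^ 3) := by field_simp; ring
    _ ≤ (1 + 2 * s * c) / (16 * π ^ 2 * s ^ 2 * c ^ 3) := by
      gcongr
      nlinarith
    _ = _ := by field_simp; ring
end
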